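/- Let U be an even MPO tensor in Graded Canonical Form (as an even tensor in the doubled physical index) generating a type II fMPU with antiperiodic boundary conditions. Then there exists k ≥ 1 such that for every q ≥ k: r(U_q)·ℓ(U_q) = 2·d^{2q}, and the exponentiated index √(r(U_q)/ℓ(U_q)) is independent of q for q ≥ k and equals √2 times a positive rational number. -/

import Mathlib

open Matrix Kronecker
open scoped ComplexOrder

namespace FQCA

noncomputable section

/-- The sign `(-1)^x` associated with a parity `x ∈ ℤ₂`. -/
def sgn (x : ZMod 2) : ℂ := (-1 : ℂ) ^ x.val

/-- Entrywise complex conjugation of a matrix. -/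
def mconj {m n : Type*} (A : Matrix m n ℂ) : Matrix m n ℂ := A.map (starRingEnd ℂ)

/-- A diagonal matrix with diagonal entries `±1`. -/
def IsParityMatrix {ν : Type*} (Z : Matrix ν ν ℂ) : Prop :=
  Z.IsDiag ∧ ∀ α, Z α α = 1 ∨ Z α α = -1

/-- An even tensor: `Z * A i = (-1)^{|i|} A i * Z`. -/
def EvenTensor {ι ν : Type*} [Fintype ν] (p : ι → ZMod 2)
    (A : ι → Matrix ν ν ℂ) (Z : Matrix ν ν ℂ) : Prop :=
  ∀ i, Z * A i = sgn (p i) • (A i * Z)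

/-- The transfer matrix `E_A = Σ_i A^i ⊗ conj (A^i)`. -/
def transfer {ι ν : Type*} [Fintype ι] (A : ι → Matrix ν ν ℂ) :
    Matrix (ν × ν) (ν × ν) ℂ :=
  ∑ i, (A i) ⊗ₖ (mconj (A i))

/-- `P` is the orthogonal projector of a nonzero proper graded invariant subspace for `A`. -/
def GradedInvariantProj {ι ν : Type*} [Fintype ν] [DecidableEq ν]
    (A : ι → Matrix ν ν ℂ) (Z P : Matrix ν ν ℂ) : Prop :=
  P * P = P ∧ Pᴴ = P ∧ P ≠ 0 ∧ P ≠ 1 ∧ P * Z = Z * P ∧ ∀ i, A i * P = P * (A i * P)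

/-- A graded irreducible tensor: no nonzero proper graded invariant subspace. -/
def GradedIrreducible {ι ν : Type*} [Fintype ν] [DecidableEq ν]
    (A : ι → Matrix ν ν ℂ) (Z : Matrix ν ν ℂ) : Prop :=
  ¬ ∃ P, GradedInvariantProj A Z P

/-- A graded normal tensor, `mult = 1` (non-degenerate) or `2` (degenerate):
graded irreducible, `1` is an eigenvalue of the transfer matrix of algebraic multiplicity
`mult`, and all other eigenvalues have modulus `< 1`. -/
def GradedNormal {ι ν : Type*} [Fintype ι] [Fintype ν] [DecidableEq ν]
    (A : ι → Matrix ν ν ℂ) (Z : Matrix ν ν ℂ) (mult : ℕ) : Prop :=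
  GradedIrreducible A Z ∧
  (Matrix.charpoly (transfer A)).rootMultiplicity 1 = mult ∧
  ∀ μ ∈ spectrum ℂ (transfer A), μ ≠ 1 → ‖μ‖ < 1

/-- Graded Canonical Form: `A^i = ⊕ₖ μₖ Aₖ^i` with `Z` block diagonal in the same way and
every block a graded normal tensor. -/
def GCF {ι ν : Type*} [Fintype ι] [Fintype ν] [DecidableEq ν]
    (p : ι → ZMod 2) (A : ι → Matrix ν ν ℂ) (Z : Matrix ν ν ℂ) : Prop :=
  ∃ (g : ℕ) (Dk : Fin g → ℕ) (e : ν ≃ ((k : Fin g) × Fin (Dk k)))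
    (μ : Fin g → ℂ)
    (Ak : (k : Fin g) → ι → Matrix (Fin (Dk k)) (Fin (Dk k)) ℂ)
    (Zk : (k : Fin g) → Matrix (Fin (Dk k)) (Fin (Dk k)) ℂ),
    0 < g ∧
    (∀ i, Matrix.reindex e e (A i) = Matrix.blockDiagonal' (fun k => μ k • Ak k i)) ∧
    Matrix.reindex e e Z = Matrix.blockDiagonal' Zk ∧
    ∀ k, IsParityMatrix (Zk k) ∧ EvenTensor p (Ak k) (Zk k) ∧
      (GradedNormal (Ak k) (Zk k) 1 ∨ GradedNormal (Ak k) (Zk k) 2)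

/-- The coefficient `tr(A^{n₁} ⋯ A^{n_N})` of the fMPS with antiperiodic boundary
conditions generated by the tensor `A`. -/
def mpsCoeff {ι ν : Type*} [Fintype ν] [DecidableEq ν] {N : ℕ}
    (A : ι → Matrix ν ν ℂ) (n : Fin N → ι) : ℂ :=
  ((List.ofFn fun j => A (n j)).prod).trace

/-- The fermionic sign `σ(n,m) = Σ_{k<j} (|n_j|+|m_j|)·|m_k|` of an fMPO matrix element. -/
def mpoSign {ι : Type*} (p : ι → ZMod 2) {N : ℕ} (n m : Fin N → ι) : ZMod 2 :=
  ∑ jk ∈ Finset.univ.filter (fun jk : Fin N × Fin N => jk.2 < jk.1),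
    (p (n jk.1) + p (m jk.1)) * p (m jk.2)

/-- The fMPO with antiperiodic boundary conditions generated by the MPO tensor `U`. -/
def fMPO {ι : Type*} (p : ι → ZMod 2) {ν : Type*} [Fintype ν] [DecidableEq ν]
    (U : ι → ι → Matrix ν ν ℂ) (N : ℕ) :
    Matrix (Fin N → ι) (Fin N → ι) ℂ :=
  Matrix.of fun n m =>
    sgn (mpoSign p n m) * ((List.ofFn fun j => U (n j) (m j)).prod).trace

/-- The fMPO with periodic boundary conditions generated by the MPO tensor `U`
(parity operator `Z` inserted in the trace). -/
def fMPO_PBC {ι : Type*} (p : ι → ZMod 2) {ν : Type*} [Fintype ν] [DecidableEq ν]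
    (Z : Matrix ν ν ℂ) (U : ι → ι → Matrix ν ν ℂ) (N : ℕ) :
    Matrix (Fin N → ι) (Fin N → ι) ℂ :=
  Matrix.of fun n m =>
    sgn (mpoSign p n m) * (Z * (List.ofFn fun j => U (n j) (m j)).prod).trace

/-- The fermionic blocking sign `τ(n,m) = Σ_{j<l} |m_j|·(|n_l|+|m_l|)`. -/
def blockSign {ι : Type*} (p : ι → ZMod 2) {q : ℕ} (n m : Fin q → ι) : ZMod 2 :=
  ∑ jl ∈ Finset.univ.filter (fun jl : Fin q × Fin q => jl.1 < jl.2),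
    p (m jl.1) * (p (n jl.2) + p (m jl.2))

/-- The `q`-fold blocked MPO tensor, with the fermionic blocking signs. -/
def blocked {ι : Type*} (p : ι → ZMod 2) {ν : Type*} [Fintype ν] [DecidableEq ν]
    (U : ι → ι → Matrix ν ν ℂ) (q : ℕ) :
    (Fin q → ι) → (Fin q → ι) → Matrix ν ν ℂ :=
  fun n m => sgn (blockSign p n m) • ((List.ofFn fun j => U (n j) (m j)).prod)

/-- The right rank `r(U)`: rank of the matrix with entry
`(-1)^{|n||m|} (U^{n,m})_{α,β}` in row `(n,β)` and column `(m,α)`. -/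
def rightRank {ι ν : Type*} [Fintype ι] [Fintype ν]
    (p : ι → ZMod 2) (U : ι → ι → Matrix ν ν ℂ) : ℕ :=
  (Matrix.of fun (r c : ι × ν) => sgn (p r.1 * p c.1) * U r.1 c.1 c.2 r.2).rank

/-- The left rank `ℓ(U)`: rank of the matrix with entry `(U^{n,m})_{α,β}`
in row `(n,α)` and column `(m,β)`. -/
def leftRank {ι ν : Type*} [Fintype ι] [Fintype ν]
    (U : ι → ι → Matrix ν ν ℂ) : ℕ :=
  (Matrix.of fun (r c : ι × ν) => U r.1 c.1 r.2 c.2).rank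

/-- The Pauli matrix `σˣ`, indexed by `Bool`. -/
def pauliX : Matrix Bool Bool ℂ := Matrix.of fun a b => if a = b then 0 else 1

/-- The Pauli matrix `σᶻ`, indexed by `Bool`. -/
def pauliZ : Matrix Bool Bool ℂ := Matrix.diagonal (fun b => if b then -1 else 1)

/-- The single-site physical parity matrix `P = diag((-1)^{|i|})`. -/
def singleP {ι : Type*} [DecidableEq ι] (p : ι → ZMod 2) : Matrix ι ι ℂ :=
  Matrix.diagonal (fun i => sgn (p i))

/-- The parity of the doubled physical index `(n,m)` of an MPO tensor. -/
def doubledP {ι : Type*} (p : ι → ZMod 2) : ι × ι → ZMod 2 :=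
  fun nm => p nm.1 + p nm.2

/-- An MPO tensor regarded as a tensor in the doubled physical index. -/
def doubledT {ι ν : Type*} (U : ι → ι → Matrix ν ν ℂ) : ι × ι → Matrix ν ν ℂ :=
  fun nm => U nm.1 nm.2

/-- An MPO tensor rescaled by `c`, regarded as a tensor in the doubled physical index. -/
def mpoScaled {ι ν : Type*} (c : ℂ) (U : ι → ι → Matrix ν ν ℂ) : ι × ι → Matrix ν ν ℂ :=
  fun nm => c • U nm.1 nm.2

/-- The parity operator `σᶻ ⊗ I` on the bond space `Bool × Fin b`. -/
def ZBP (b : ℕ) : Matrix (Bool × Fin b) (Bool × Fin b) ℂ :=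
  pauliZ ⊗ₖ (1 : Matrix (Fin b) (Fin b) ℂ)

/-- Structure of a type II MPO tensor: `U^{n,m} = (σˣ)^{|n|+|m|} ⊗ N^{n,m}`. -/
def TypeIIStruct {d b : ℕ} (p : Fin d → ZMod 2)
    (U : Fin d → Fin d → Matrix (Bool × Fin b) (Bool × Fin b) ℂ) : Prop :=
  ∃ Nm : Fin d → Fin d → Matrix (Fin b) (Fin b) ℂ,
    ∀ n m', U n m' = (pauliX ^ (p n + p m').val) ⊗ₖ Nm n m'

/-- The parity matrix of the product grading on `q` sites. -/
def bigP {d : ℕ} (p : Fin d → ZMod 2) (q : ℕ) :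
    Matrix (Fin q → Fin d) (Fin q → Fin d) ℂ :=
  Matrix.diagonal (fun n => sgn (∑ i, p (n i)))

/-- The Jordan-Wigner embedding at site `j` of a local operator `O` homogeneous of
parity `o`: `P^{|O|} ⊗ ⋯ ⊗ P^{|O|} ⊗ O ⊗ I ⊗ ⋯ ⊗ I`. -/
def jordanWigner {d N : ℕ} (p : Fin d → ZMod 2) (o : ZMod 2)
    (O : Matrix (Fin d) (Fin d) ℂ) (j : Fin N) :
    Matrix (Fin N → Fin d) (Fin N → Fin d) ℂ :=
  Matrix.of fun n m =>
    (∏ l ∈ Finset.univ.filter (fun l : Fin N => l < j),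
      ((singleP p) ^ o.val) (n l) (m l)) *
    O (n j) (m j) *
    (∏ l ∈ Finset.univ.filter (fun l : Fin N => j < l),
      (if n l = m l then (1:ℂ) else 0))

/-- The right rank of the `q`-fold blocked MPO tensor. -/
def rrBlocked {d : ℕ} {ν : Type*} [Fintype ν] (p : Fin d → ZMod 2)
    (U : Fin d → Fin d → Matrix ν ν ℂ) [DecidableEq ν] (q : ℕ) : ℕ :=
  rightRank (fun n : Fin q → Fin d => ∑ j, p (n j)) (blocked p U q)

/-- The left rank of the `q`-fold blocked MPO tensor. -/
def llBlocked {d : ℕ} {ν : Type*} [Fintype ν] (p : Fin d → ZMod 2)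
    (U : Fin d → Fin d → Matrix ν ν ℂ) [DecidableEq ν] (q : ℕ) : ℕ :=
  leftRank (blocked p U q)

theorem eq_zero_of_mul_self_of_trace {ν : Type*} [Fintype ν] [DecidableEq ν]
    {e : Matrix ν ν ℂ} (he : e * e = e) (ht : e.trace = 0) : e = 0 := by
  have h : IsIdempotentElem (Matrix.toLin' e) := by
    rw [IsIdempotentElem, Module.End.mul_eq_comp, ← Matrix.toLin'_mul, he]
  have := LinearMap.IsIdempotentElem.eq_zero_of_trace_eq_zero h (by rw [trace_toLin'_eq, ht])
  simpa using this

theorem trace_aeval_X_mul {ν : Type*} [Fintype ν] [DecidableEq ν]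
    (A : Matrix ν ν ℂ) (t : ℂ) (h : ∀ j : ℕ, 1 ≤ j → (A ^ j).trace = t) (q : Polynomial ℂ) :
    (Polynomial.aeval A (Polynomial.X * q)).trace = t * q.eval 1 := by
  induction q using Polynomial.induction_on' with
  | add p q hp hq => rw [mul_add, map_add, trace_add, hp, hq, Polynomial.eval_add, mul_add]
  | monomial n a =>
    rw [← Polynomial.monomial_one_one_eq_X, Polynomial.monomial_mul_monomial,
      Polynomial.aeval_monomial, Polynomial.eval_monomial, ← Algebra.smul_def, trace_smul,
      h _ (by omega)]
    simp [mul_comm]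

theorem isNilpotent_of_trace_pow {ν : Type*} [Fintype ν] [DecidableEq ν]
    (A : Matrix ν ν ℂ) (h : ∀ j : ℕ, 1 ≤ j → (A ^ j).trace = 0) : IsNilpotent A := by
  obtain ⟨g, hg, hnd⟩ := Polynomial.exists_eq_pow_rootMultiplicity_mul_and_not_dvd A.charpoly
    A.charpoly_monic.ne_zero 0
  set a := A.charpoly.rootMultiplicity 0
  rw [Polynomial.C_0, sub_zero] at hg hnd
  have hcop : IsCoprime (Polynomial.X ^ (a + 1)) g :=
    IsCoprime.pow_left ((Polynomial.prime_X.irreducible.coprime_iff_not_dvd).2 hnd)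
  obtain ⟨u, v, huv⟩ := hcop
  have hCH : A ^ a * Polynomial.aeval A g = 0 := by
    have := A.aeval_self_charpoly
    rwa [hg, map_mul, map_pow, Polynomial.aeval_X] at this
  set e := Polynomial.aeval A (u * Polynomial.X ^ (a + 1)) with he
  have h1 : e + Polynomial.aeval A (v * g) = 1 := by rw [he, ← map_add, huv, map_one]
  have h2 : e * Polynomial.aeval A (v * g) = 0 := by
    rw [he, ← map_mul, show u * Polynomial.X ^ (a + 1) * (v * g)
      = (Polynomial.X ^ a * g) * (u * v * Polynomial.X) by ring, map_mul, map_mul, map_pow,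
      Polynomial.aeval_X, hCH, zero_mul]
  have h3 : e * e = e := by
    have := congrArg (e * ·) h1
    simpa only [mul_add, h2, add_zero, mul_one] using this
  have h4 : e.trace = 0 := by
    rw [he, show u * Polynomial.X ^ (a + 1) = Polynomial.X * (u * Polynomial.X ^ a) by ring,
      trace_aeval_X_mul A 0 h, zero_mul]
  rw [eq_zero_of_mul_self_of_trace h3 h4, zero_add] at h1
  refine ⟨a, ?_⟩
  rw [← mul_one (A ^ a), ← h1, mul_comm v g, map_mul, ← mul_assoc, hCH, zero_mul]

/-- A multiplicatively closed space of nilpotent matrices is nilpotent (Engel). -/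
theorem exists_list_prod_eq_zero {ν : Type*} [Fintype ν] [DecidableEq ν]
    (S : Submodule ℂ (Matrix ν ν ℂ)) (hmul : ∀ a ∈ S, ∀ b ∈ S, a * b ∈ S)
    (hnil : ∀ a ∈ S, IsNilpotent a) :
    ∃ k : ℕ, ∀ l : List (Matrix ν ν ℂ), l.length = k → (∀ a ∈ l, a ∈ S) → l.prod = 0 := by
  let _ : LieRing (Matrix ν ν ℂ) := LieRing.ofAssociativeRing
  let K : LieSubalgebra ℂ (Matrix ν ν ℂ) :=
    { S with
      lie_mem' := by
        intro a b ha hb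
        exact S.sub_mem (hmul a ha b hb) (hmul b hb a ha) }
  have hN : LieModule.IsNilpotent K (ν → ℂ) := by
    rw [LieModule.isNilpotent_iff_forall' (R := ℂ)]
    rintro ⟨a, ha⟩
    exact (hnil a ha).map (Matrix.toLinAlgEquiv' (R := ℂ) (n := ν))
  obtain ⟨k, hk⟩ := (LieModule.isNilpotent_iff ℂ K (ν → ℂ)).1 hN
  refine ⟨k, fun l hl hS => ?_⟩
  have key : ∀ l : List (Matrix ν ν ℂ), (∀ a ∈ l, a ∈ S) → ∀ x : ν → ℂ,
      l.prod *ᵥ x ∈ LieModule.lowerCentralSeries ℂ K (ν → ℂ) l.length := by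
    intro l
    induction l with
    | nil => simp
    | cons a l ih =>
      intro h x
      have hx := ih (fun b hb => h b (by simp [hb])) x
      have ha : a ∈ K := h a (by simp)
      rw [List.length_cons, LieModule.lowerCentralSeries_succ]
      have := LieSubmodule.lie_mem_lie (LieSubmodule.mem_top (R := ℂ) (L := K) (⟨a, ha⟩ : K)) hx
      rw [List.prod_cons, ← Matrix.mulVec_mulVec]
      exact this
  apply Matrix.toLin'.injective
  ext1 x
  have := key l hS
  rw [hl, hk] at this
  ext1
  simpa using this (Pi.single x 1)

theorem _root_.Matrix.IsHermitian.exists_diagonalization {k : Type*} [Fintype k] [DecidableEq k]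
    {M : Matrix k k ℂ} (hM : M.IsHermitian) :
    ∃ (V W : Matrix k k ℂ) (c : k → ℂ), V * W = 1 ∧ W * V = 1 ∧ M = V * diagonal c * W := by
  refine ⟨hM.eigenvectorUnitary, star (hM.eigenvectorUnitary : Matrix k k ℂ),
    RCLike.ofReal ∘ hM.eigenvalues, by simp, by simp, ?_⟩
  simpa only [Unitary.conjStarAlgAut_apply] using hM.spectral_theorem

theorem rank_conj_of_mul_eq_one {k : Type*} [Fintype k] [DecidableEq k] {V W : Matrix k k ℂ}
    (h : V * W = 1) (h' : W * V = 1) (M : Matrix k k ℂ) : (V * M * W).rank = M.rank := by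
  rw [rank_mul_eq_left_of_isUnit_det _ _ (isUnit_det_of_left_inverse h),
    rank_mul_eq_right_of_isUnit_det _ _ (isUnit_det_of_left_inverse h')]

theorem rank_kronecker {m n m' n' : Type*} [Fintype m] [Fintype n] [Fintype m'] [Fintype n']
    (A : Matrix m n ℂ) (B : Matrix m' n' ℂ) : (A ⊗ₖ B).rank = A.rank * B.rank := by
  classical
  rw [← rank_conjTranspose_mul_self A, ← rank_conjTranspose_mul_self B,
    ← rank_conjTranspose_mul_self, conjTranspose_kronecker, ← mul_kronecker_mul]
  obtain ⟨V, W, c, h1, h2, h3⟩ := (isHermitian_conjTranspose_mul_self A).exists_diagonalization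
  obtain ⟨V', W', c', h1', h2', h3'⟩ :=
    (isHermitian_conjTranspose_mul_self B).exists_diagonalization
  rw [h3, h3', mul_kronecker_mul, mul_kronecker_mul, rank_conj_of_mul_eq_one h1 h2,
    rank_conj_of_mul_eq_one h1' h2', rank_conj_of_mul_eq_one
      (by rw [← mul_kronecker_mul, h1, h1', one_kronecker_one])
      (by rw [← mul_kronecker_mul, h2, h2', one_kronecker_one]),
    diagonal_kronecker_diagonal, rank_diagonal, rank_diagonal, rank_diagonal,
    ← Fintype.card_prod]
  refine Fintype.card_congr ⟨fun x => (⟨x.1.1, fun h => x.2 (by simp [h])⟩,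
    ⟨x.1.2, fun h => x.2 (by simp [h])⟩), fun x => ⟨(x.1.1, x.2.1), mul_ne_zero x.1.2 x.2.2⟩,
    fun x => rfl, fun x => rfl⟩

theorem rank_sign {m n : Type*} [Fintype m] [Fintype n]
    (A B : Matrix m n ℂ) (u : m → ℂ) (v : n → ℂ) (hu : ∀ i, u i ≠ 0) (hv : ∀ i, v i ≠ 0)
    (h : ∀ i j, A i j = u i * B i j * v j) : A.rank = B.rank := by
  classical
  have : A = diagonal u * B * diagonal v := by
    ext i j; simp [h]
  rw [this, rank_mul_eq_left_of_det_ne_zero, rank_mul_eq_right_of_det_ne_zero] <;>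
    simp [Finset.prod_ne_zero_iff, hu, hv]

theorem rank_eq_of_ker {m m' n : Type*} [Fintype m] [Fintype m'] [Fintype n]
    (A : Matrix m n ℂ) (B : Matrix m' n ℂ) (h : ∀ x, A *ᵥ x = 0 ↔ B *ᵥ x = 0) :
    A.rank = B.rank := by
  have hk : LinearMap.ker A.mulVecLin = LinearMap.ker B.mulVecLin := by
    ext x; simpa using h x
  have h1 := A.mulVecLin.finrank_range_add_finrank_ker
  have h2 := B.mulVecLin.finrank_range_add_finrank_ker
  rw [hk] at h1
  unfold Matrix.rank
  omega

theorem exists_vecMulVec_of_trace_eq_one {ν : Type*} [Fintype ν] [DecidableEq ν]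
    {e : Matrix ν ν ℂ} (he : e * e = e) (ht : e.trace = 1) : ∃ x y, e = vecMulVec x y := by
  have h : IsIdempotentElem (Matrix.toLin' e) := by
    rw [IsIdempotentElem, Module.End.mul_eq_comp, ← Matrix.toLin'_mul, he]
  have h1 := (LinearMap.IsIdempotentElem.isProj_range _ h).trace
  rw [trace_toLin'_eq, ht] at h1
  obtain ⟨x, -, hx⟩ := finrank_eq_one_iff'.1 (by exact_mod_cast h1.symm :
    Module.finrank ℂ (LinearMap.range (Matrix.toLin' e)) = 1)
  choose c hc using fun j => hx ⟨e *ᵥ Pi.single j 1, ⟨Pi.single j 1, rfl⟩⟩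
  refine ⟨x, c, ?_⟩
  ext i j
  have := congrFun (congrArg Subtype.val (hc j)) i
  simp only [mulVec_single_one, SetLike.val_smul, Pi.smul_apply, smul_eq_mul, col_apply] at this
  rw [vecMulVec_apply, mul_comm, this]

theorem vecMulVec_mul_mul_vecMulVec {ν : Type*} [Fintype ν] [DecidableEq ν]
    (x y : ν → ℂ) (a : Matrix ν ν ℂ) :
    vecMulVec x y * a * vecMulVec x y = (vecMulVec x y * a).trace • vecMulVec x y := by
  rw [vecMulVec_mul, vecMulVec_mul_vecMulVec, trace_vecMulVec, dotProduct_comm x]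
  ext i j
  simp only [vecMulVec_apply, Pi.smul_apply, Matrix.smul_apply, smul_eq_mul]
  ring

theorem exists_idempotent_aeval {ν : Type*} [Fintype ν] [DecidableEq ν] (E : Matrix ν ν ℂ)
    (hEpow : ∀ j : ℕ, 1 ≤ j → (E ^ j).trace = 1) (hnil : IsNilpotent (E * E - E)) :
    ∃ e, (∃ q : Polynomial ℂ, Polynomial.aeval E (Polynomial.X * q) = e) ∧ e * e = e ∧
      e.trace = 1 ∧ E * e = e * E := by
  obtain ⟨m, hm⟩ := hnil
  replace hm : (E * E - E) ^ (m + 1) = 0 := by rw [pow_succ, hm, zero_mul]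
  have hcop : IsCoprime (Polynomial.X ^ (m + 1) : Polynomial ℂ) ((Polynomial.X - 1) ^ (m + 1)) :=
    IsCoprime.pow ⟨1, -1, by ring⟩
  obtain ⟨u, w, huw⟩ := hcop
  refine ⟨Polynomial.aeval E (Polynomial.X * (u * Polynomial.X ^ m)), ⟨_, rfl⟩, ?_, ?_, ?_⟩
  · have h1 : Polynomial.aeval E (Polynomial.X * (u * Polynomial.X ^ m)) +
        Polynomial.aeval E (w * (Polynomial.X - 1) ^ (m + 1)) = 1 := by
      have h := congrArg (Polynomial.aeval E) huw
      rwa [map_add, map_one, show u * Polynomial.X ^ (m + 1) =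
        Polynomial.X * (u * Polynomial.X ^ m) by ring] at h
    have h2 : Polynomial.aeval E (Polynomial.X * (u * Polynomial.X ^ m)) *
        Polynomial.aeval E (w * (Polynomial.X - 1) ^ (m + 1)) = 0 := by
      rw [← map_mul, show Polynomial.X * (u * Polynomial.X ^ m) *
        (w * (Polynomial.X - 1) ^ (m + 1)) =
        (Polynomial.X * Polynomial.X - Polynomial.X) ^ (m + 1) * (u * w) by
          rw [show (Polynomial.X * Polynomial.X - Polynomial.X : Polynomial ℂ) =
            Polynomial.X * (Polynomial.X - 1) by ring, mul_pow]; ring, map_mul]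
      simp [hm]
    have := congrArg (Polynomial.aeval E (Polynomial.X * (u * Polynomial.X ^ m)) * ·) h1
    simpa only [mul_add, h2, add_zero, mul_one] using this
  · rw [trace_aeval_X_mul E 1 hEpow]
    simpa using congrArg (Polynomial.eval 1) huw
  · have := congrArg (Polynomial.aeval E)
      (mul_comm Polynomial.X (Polynomial.X * (u * Polynomial.X ^ m)))
    simpa only [map_mul, Polynomial.aeval_X] using this

/-- If the trace of words in the matrices `v i` is multiplicative, then long words factor through
a rank one idempotent, given by a power of any combination of the `v i` with unit trace. -/
theorem exists_factorization_of_trace_prod {I ν : Type*} [Fintype I] [Fintype ν] [DecidableEq ν]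
    (v : I → Matrix ν ν ℂ) (χ : I → ℂ)
    (htr : ∀ l : List I, l ≠ [] → (l.map v).prod.trace = (l.map χ).prod)
    (c : I → ℂ) (hc : ∑ i, c i * χ i = 1) :
    ∃ k : ℕ, 1 ≤ k ∧ ((∑ i, c i • v i) ^ k).trace = 1 ∧
      (∃ x y, (∑ i, c i • v i) ^ k = vecMulVec x y) ∧
      ∀ l l' : List I, k ≤ l.length → k ≤ l'.length →
        (l.map v).prod * (l'.map v).prod =
          (l.map v).prod * (∑ i, c i • v i) ^ k * (l'.map v).prod := by
  set E := ∑ i, c i • v i with hE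
  let A : Submodule ℂ (Matrix ν ν ℂ) :=
    Submodule.span ℂ {a | ∃ l : List I, l ≠ [] ∧ a = (l.map v).prod}
  have hAtr : ∀ a ∈ A, ∀ b ∈ A, (a * b).trace = a.trace * b.trace ∧ a * b ∈ A := by
    intro a ha b hb
    induction ha, hb using Submodule.span_induction₂ with
    | mem_mem a b ha hb =>
      obtain ⟨l, hl, rfl⟩ := ha
      obtain ⟨l', hl', rfl⟩ := hb
      rw [← List.prod_append, ← List.map_append, htr _ (by simp [hl]), htr _ hl, htr _ hl',
        List.map_append, List.prod_append]
      exact ⟨rfl, Submodule.subset_span ⟨l ++ l', by simp [hl], rfl⟩⟩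
    | zero_left => simp
    | zero_right => simp
    | add_left x y z _ _ _ h1 h2 =>
      rw [add_mul, trace_add, trace_add, h1.1, h2.1, add_mul]
      exact ⟨rfl, A.add_mem h1.2 h2.2⟩
    | add_right x y z _ _ _ h1 h2 =>
      rw [mul_add, trace_add, trace_add, h1.1, h2.1, mul_add]
      exact ⟨rfl, A.add_mem h1.2 h2.2⟩
    | smul_left r x y _ _ h =>
      rw [smul_mul_assoc, trace_smul, trace_smul, h.1, smul_mul_assoc]
      exact ⟨rfl, A.smul_mem _ h.2⟩
    | smul_right r x y _ _ h =>
      rw [mul_smul_comm, trace_smul, trace_smul, h.1, mul_smul_comm]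
      exact ⟨rfl, A.smul_mem _ h.2⟩
  have hApow : ∀ a ∈ A, ∀ j : ℕ, 1 ≤ j → a ^ j ∈ A ∧ (a ^ j).trace = a.trace ^ j := by
    intro a ha j hj
    induction j, hj using Nat.le_induction with
    | base => simpa using ha
    | succ j _ ih =>
      have := hAtr _ ih.1 _ ha
      rw [pow_succ, this.1, ih.2, pow_succ]
      exact ⟨this.2, rfl⟩
  have hvA : ∀ i, v i ∈ A := fun i => Submodule.subset_span ⟨[i], by simp, by simp⟩
  have hvtr : ∀ i, (v i).trace = χ i := fun i => by simpa using htr [i] (by simp)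
  have hEA : E ∈ A := A.sum_mem fun i _ => A.smul_mem _ (hvA i)
  have hEtr : E.trace = 1 := by rw [hE, trace_sum, ← hc]; simp [trace_smul, hvtr]
  let S : Submodule ℂ (Matrix ν ν ℂ) := A ⊓ LinearMap.ker (traceLinearMap ν ℂ ℂ)
  have hS : ∀ a, a ∈ S ↔ a ∈ A ∧ a.trace = 0 := fun a => by simp [S]
  have hSnil : ∀ a ∈ S, IsNilpotent a := fun a ha =>
    isNilpotent_of_trace_pow a fun j hj => by
      rw [(hApow a ((hS a).1 ha).1 j hj).2, ((hS a).1 ha).2, zero_pow (by omega)]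
  obtain ⟨k, hk⟩ := exists_list_prod_eq_zero S (fun a ha b hb => by
    rw [hS] at ha hb ⊢
    obtain ⟨h1, h2⟩ := hAtr a ha.1 b hb.1
    exact ⟨h2, by rw [h1, ha.2, zero_mul]⟩) hSnil
  have hk' : ∀ l : List (Matrix ν ν ℂ), k ≤ l.length → (∀ a ∈ l, a ∈ S) → l.prod = 0 := by
    intro l hl h
    rw [← List.take_append_drop k l, List.prod_append,
      hk _ (by simpa using hl) (fun a ha => h a (List.mem_of_mem_take ha)), zero_mul]
  have hEpow : ∀ j : ℕ, 1 ≤ j → (E ^ j).trace = 1 := fun j hj => by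
    rw [(hApow E hEA j hj).2, hEtr, one_pow]
  have hEq : ∀ q : Polynomial ℂ, Polynomial.aeval E (Polynomial.X * q) ∈ A := by
    intro q
    induction q using Polynomial.induction_on' with
    | add p q hp hq => rw [mul_add, map_add]; exact A.add_mem hp hq
    | monomial n a =>
      rw [← Polynomial.monomial_one_one_eq_X, Polynomial.monomial_mul_monomial,
        Polynomial.aeval_monomial, ← Algebra.smul_def]
      exact A.smul_mem _ (hApow E hEA _ (by omega)).1
  obtain ⟨e, ⟨q, hq⟩, he, het, hcomm⟩ := exists_idempotent_aeval E hEpow ((hS _).2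
      ⟨A.sub_mem (hAtr E hEA E hEA).2 hEA, by
        rw [trace_sub, (hAtr E hEA E hEA).1, hEtr]; norm_num⟩ |> hSnil _)
  have heA : e ∈ A := hq ▸ hEq q
  obtain ⟨x, y, hxy⟩ := exists_vecMulVec_of_trace_eq_one he het
  have heae : ∀ a ∈ A, e * a * e = a.trace • e := fun a ha => by
    have := vecMulVec_mul_mul_vecMulVec x y a
    rwa [← hxy, (hAtr e heA a ha).1, het, one_mul] at this
  have hEe : E * e = e := by
    rw [← he, ← mul_assoc, hcomm, heae E hEA, hEtr, one_smul, he]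
  have hEk : E ^ (k + 1) = e := by
    have hn : (E - e) ^ (k + 1) = 0 := by
      have := hk' (List.replicate (k + 1) (E - e)) (by simp) fun a ha => by
        rw [List.eq_of_mem_replicate ha, hS, trace_sub, hEtr, het, sub_self]
        exact ⟨A.sub_mem hEA heA, rfl⟩
      simpa using this
    have : ∀ j : ℕ, E ^ (j + 1) = e + (E - e) ^ (j + 1) := by
      intro j
      induction j with
      | zero => simp
      | succ j ih =>
        have h0 : (E - e) * e = 0 := by rw [sub_mul, hEe, he, sub_self]
        have h1 : (E - e) ^ (j + 1) * E = (E - e) ^ (j + 1 + 1) := by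
          rw [pow_succ _ (j + 1), mul_sub, pow_succ _ j, mul_assoc _ (E - e) e, h0, mul_zero,
            sub_zero]
        rw [pow_succ E (j + 1), ih, add_mul, ← hcomm, hEe, h1]
    rw [this, hn, add_zero]
  refine ⟨k + 1, by omega, hEk ▸ het, ⟨x, y, hEk.trans hxy⟩, ?_⟩
  rw [hEk]
  let A1 : Submodule ℂ (Matrix ν ν ℂ) := Submodule.span ℂ (Set.range fun l : List I => (l.map v).prod)
  have hA1 : ∀ a ∈ A1, ∀ b ∈ A1, e * a * b * e = e * a * e * b * e := by
    intro a ha b hb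
    induction ha, hb using Submodule.span_induction₂ with
    | mem_mem a b ha hb =>
      obtain ⟨l, rfl⟩ := ha
      obtain ⟨l', rfl⟩ := hb
      dsimp only
      by_cases hl : l = []
      · simp [hl, he]
      by_cases hl' : l' = []
      · simp [hl', mul_assoc, he]
      have h1 : (l.map v).prod ∈ A := Submodule.subset_span ⟨l, hl, rfl⟩
      have h2 : (l'.map v).prod ∈ A := Submodule.subset_span ⟨l', hl', rfl⟩
      rw [heae _ h1, mul_assoc e, heae _ (hAtr _ h1 _ h2).2, smul_mul_assoc, smul_mul_assoc,
        heae _ h2, smul_smul, (hAtr _ h1 _ h2).1]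
    | zero_left => simp
    | zero_right => simp
    | add_left x y z _ _ _ h1 h2 => simp only [mul_add, add_mul, h1, h2]
    | add_right x y z _ _ _ h1 h2 => simp only [mul_add, add_mul, h1, h2]
    | smul_left r x y _ _ h => simp only [smul_mul_assoc, mul_smul_comm, h]
    | smul_right r x y _ _ h => simp only [smul_mul_assoc, mul_smul_comm, h]
  have hA1m : ∀ a ∈ A1, ∀ b ∈ A1, a * b ∈ A1 := by
    intro a ha b hb
    induction ha, hb using Submodule.span_induction₂ with
    | mem_mem a b ha hb =>
      obtain ⟨l, rfl⟩ := ha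
      obtain ⟨l', rfl⟩ := hb
      exact Submodule.subset_span ⟨l ++ l', by simp⟩
    | zero_left => simp
    | zero_right => simp
    | add_left x y z _ _ _ h1 h2 => rw [add_mul]; exact A1.add_mem h1 h2
    | add_right x y z _ _ _ h1 h2 => rw [mul_add]; exact A1.add_mem h1 h2
    | smul_left r x y _ _ h => rw [smul_mul_assoc]; exact A1.smul_mem _ h
    | smul_right r x y _ _ h => rw [mul_smul_comm]; exact A1.smul_mem _ h
  have hAA1 : A ≤ A1 := Submodule.span_mono fun a ⟨l, _, ha⟩ => ⟨l, ha.symm⟩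
  have hwA1 : ∀ l : List I, (l.map v).prod ∈ A1 := fun l => Submodule.subset_span ⟨l, rfl⟩
  let T : Submodule ℂ (Matrix ν ν ℂ) :=
    Submodule.span ℂ {t | ∃ a ∈ A1, ∃ b ∈ A1, t = a * e * b}
  have hTA : ∀ a ∈ A1, ∀ t ∈ T, a * t ∈ T := by
    intro a ha t ht
    induction ht using Submodule.span_induction with
    | mem t ht =>
      obtain ⟨a', ha', b, hb, rfl⟩ := ht
      exact Submodule.subset_span ⟨a * a', hA1m _ ha _ ha', b, hb, by simp only [mul_assoc]⟩
    | zero => simp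
    | add x y _ _ h1 h2 => rw [mul_add]; exact T.add_mem h1 h2
    | smul r x _ h => rw [mul_smul_comm]; exact T.smul_mem _ h
  have hTT : ∀ t ∈ T, ∀ t' ∈ T, t * t' = t * e * t' := by
    intro t ht t' ht'
    induction ht, ht' using Submodule.span_induction₂ with
    | mem_mem t t' ht ht' =>
      obtain ⟨a, ha, b, hb, rfl⟩ := ht
      obtain ⟨a', ha', b', hb', rfl⟩ := ht'
      have := congrArg (fun z => a * z * b') (hA1 b hb a' ha')
      simpa only [mul_assoc] using this
    | zero_left => simp
    | zero_right => simp
    | add_left x y z _ _ _ h1 h2 => simp only [add_mul, h1, h2]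
    | add_right x y z _ _ _ h1 h2 => simp only [mul_add, h1, h2]
    | smul_left r x y _ _ h => simp only [smul_mul_assoc, h]
    | smul_right r x y _ _ h => simp only [mul_smul_comm, h]
  have hsS : ∀ i, v i - χ i • e ∈ S := fun i => by
    rw [hS, trace_sub, trace_smul, hvtr, het, smul_eq_mul, mul_one, sub_self]
    exact ⟨A.sub_mem (hvA i) (A.smul_mem _ heA), rfl⟩
  have hdec : ∀ l : List I, ∃ s : List (Matrix ν ν ℂ), s.length = l.length ∧ (∀ a ∈ s, a ∈ S) ∧
      (l.map v).prod - s.prod ∈ T := by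
    intro l
    induction l with
    | nil => exact ⟨[], rfl, by simp, by simp⟩
    | cons i l ih =>
      obtain ⟨s, hs, hs', hs''⟩ := ih
      refine ⟨(v i - χ i • e) :: s, by simp [hs], by simpa using ⟨hsS i, hs'⟩, ?_⟩
      have h1 : χ i • ((1 : Matrix ν ν ℂ) * e * (l.map v).prod) ∈ T :=
        T.smul_mem _ (Submodule.subset_span
          ⟨1, by simpa using hwA1 [], _, hwA1 l, rfl⟩)
      have h2 := hTA _ (hAA1 ((hS _).1 (hsS i)).1) _ hs''
      convert T.add_mem h1 h2 using 1
      simp only [List.map_cons, List.prod_cons, one_mul, mul_sub, sub_mul, smul_mul_assoc]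
      abel
  have hlong : ∀ l : List I, k + 1 ≤ l.length → (l.map v).prod ∈ T := by
    intro l hl
    obtain ⟨s, hs, hs', hs''⟩ := hdec l
    rwa [hk' s (by omega) hs', sub_zero] at hs''
  exact fun l l' hl hl' => hTT _ (hlong l hl) _ (hlong l' hl')

theorem exists_orthogonal_projection {ν : Type*} [Fintype ν] [DecidableEq ν]
    (M : Submodule ℂ (ν → ℂ)) :
    ∃ P : Matrix ν ν ℂ, P * P = P ∧ Pᴴ = P ∧ (∀ x, P *ᵥ x ∈ M) ∧ ∀ x ∈ M, P *ᵥ x = x := by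
  let K : Submodule ℂ (EuclideanSpace ℂ ν) := M.comap (WithLp.linearEquiv 2 ℂ (ν → ℂ)).toLinearMap
  let P := (toEuclideanCLM (n := ν) (𝕜 := ℂ)).symm K.starProjection
  have hP : toEuclideanCLM (n := ν) (𝕜 := ℂ) P = K.starProjection :=
    (toEuclideanCLM (n := ν) (𝕜 := ℂ)).apply_symm_apply _
  have hx : ∀ x, WithLp.toLp 2 (P *ᵥ x) = K.starProjection (WithLp.toLp 2 x) := fun x => by
    rw [← hP, toEuclideanCLM_toLp]
  refine ⟨P, ?_, ?_, fun x => ?_, fun x hxM => ?_⟩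
  · apply (toEuclideanCLM (n := ν) (𝕜 := ℂ)).injective
    refine (map_mul (toEuclideanCLM (n := ν) (𝕜 := ℂ)) P P).trans (Eq.trans ?_ hP.symm)
    rw [hP]
    exact K.isIdempotentElem_starProjection
  · apply (toEuclideanCLM (n := ν) (𝕜 := ℂ)).injective
    refine (map_star (toEuclideanCLM (n := ν) (𝕜 := ℂ)) P).trans (Eq.trans ?_ hP.symm)
    rw [hP]
    exact (isSelfAdjoint_starProjection K).star_eq
  · have := K.starProjection_apply_mem (WithLp.toLp 2 x)
    rw [← hx] at this
    exact this
  · have : K.starProjection (WithLp.toLp 2 x) = WithLp.toLp 2 x :=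
      Submodule.starProjection_eq_self_iff.2 hxM
    rw [← hx] at this
    exact congrArg WithLp.ofLp this

theorem GradedIrreducible.eq_bot_or_eq_top {ι ν : Type*} [Fintype ν] [DecidableEq ν]
    {A : ι → Matrix ν ν ℂ} {Z : Matrix ν ν ℂ} (h : GradedIrreducible A Z) (hZ : IsParityMatrix Z)
    (M : Submodule ℂ (ν → ℂ)) (hMA : ∀ i, ∀ x ∈ M, A i *ᵥ x ∈ M) (hMZ : ∀ x ∈ M, Z *ᵥ x ∈ M) :
    M = ⊥ ∨ M = ⊤ := by
  obtain ⟨P, hPP, hPH, hPM, hP⟩ := exists_orthogonal_projection M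
  by_contra! hM
  have hinv : ∀ B : Matrix ν ν ℂ, (∀ x ∈ M, B *ᵥ x ∈ M) → B * P = P * (B * P) := fun B hB =>
    Matrix.ext_of_mulVec_single fun i => by
      rw [← mulVec_mulVec _ P, ← mulVec_mulVec _ B, hP _ (hB _ (hPM _))]
  have hZH : Zᴴ = Z := by
    ext i j
    rw [conjTranspose_apply]
    by_cases hij : i = j
    · subst hij
      rcases hZ.2 i with h | h <;> simp [h]
    · rw [hZ.1 hij, hZ.1 (Ne.symm hij), star_zero]
  refine h ⟨P, hPP, hPH, ?_, ?_, ?_, fun i => hinv _ (hMA i)⟩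
  · rintro rfl
    exact hM.1 ((Submodule.eq_bot_iff _).2 fun x hx => by simpa using (hP x hx).symm)
  · rintro rfl
    exact hM.2 (Submodule.eq_top_iff'.2 fun x => by simpa using hPM x)
  · have h1 := hinv Z hMZ
    have h2 := congrArg conjTranspose h1
    simp only [conjTranspose_mul, hZH, hPH] at h2
    rw [h2, h1, mul_assoc]

theorem exists_list_prod_ne_zero {ι ν : Type*} [Fintype ι] [Fintype ν] [DecidableEq ν]
    {A : ι → Matrix ν ν ℂ} (h : 1 ∈ spectrum ℂ (transfer A)) (k : ℕ) :
    ∃ l : List ι, l.length = k ∧ (l.map A).prod ≠ 0 := by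
  by_contra! hl
  have hpow : ∀ j : ℕ, transfer A ^ j ∈ Submodule.span ℂ
      {T | ∃ l : List ι, l.length = j ∧ T = (l.map A).prod ⊗ₖ mconj (l.map A).prod} := by
    intro j
    induction j with
    | zero =>
      refine Submodule.subset_span ⟨[], rfl, ?_⟩
      simp [mconj]
    | succ j ih =>
      rw [pow_succ']
      generalize transfer A ^ j = X at ih
      induction ih using Submodule.span_induction with
      | mem x hx =>
        obtain ⟨l, hl, rfl⟩ := hx
        rw [transfer, Finset.sum_mul]
        refine Submodule.sum_mem _ fun i _ => Submodule.subset_span ⟨i :: l, by simp [hl], ?_⟩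
        rw [← mul_kronecker_mul, List.map_cons, List.prod_cons, mconj, mconj, mconj, Matrix.map_mul]
      | zero => simp
      | add x y _ _ h1 h2 => rw [mul_add]; exact Submodule.add_mem _ h1 h2
      | smul r x _ h => rw [mul_smul_comm]; exact Submodule.smul_mem _ _ h
  have h0 : transfer A ^ k = 0 := by
    refine (Submodule.mem_bot ℂ).1 (Submodule.span_le.2 ?_ (hpow k))
    rintro _ ⟨l, hlk, rfl⟩
    simp [hl l hlk]
  rw [← Matrix.spectrum_toLin', ← Module.End.hasEigenvalue_iff_mem_spectrum] at h
  obtain ⟨v, hv, hv0⟩ := h.exists_hasEigenvector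
  rw [Module.End.mem_eigenspace_iff, toLin'_apply, one_smul] at hv
  have hpv : ∀ j : ℕ, transfer A ^ j *ᵥ v = v := by
    intro j
    induction j with
    | zero => simp
    | succ j ih => rw [pow_succ, ← mulVec_mulVec, hv, ih]
  exact hv0 (by rw [← hpv k, h0, zero_mulVec])

theorem list_prod_mul_parity {ι ν : Type*} [Fintype ν] [DecidableEq ν] {p : ι → ZMod 2}
    {A : ι → Matrix ν ν ℂ} {Z : Matrix ν ν ℂ} (hE : EvenTensor p A Z) (l : List ι) :
    ∃ s : ℂ, s ≠ 0 ∧ Z * (l.map A).prod = s • ((l.map A).prod * Z) := by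
  induction l with
  | nil => exact ⟨1, one_ne_zero, by simp⟩
  | cons i l ih =>
    obtain ⟨s, hs, h⟩ := ih
    refine ⟨sgn (p i) * s, mul_ne_zero (pow_ne_zero _ (by norm_num)) hs, ?_⟩
    rw [List.map_cons, List.prod_cons, ← mul_assoc, hE i, smul_mul_assoc, mul_assoc, h,
      mul_smul_comm, smul_smul, mul_assoc]

section block

variable {ι ν : Type*} [Fintype ι] [Fintype ν] [DecidableEq ν] {p : ι → ZMod 2}
  {A : ι → Matrix ν ν ℂ} {Z : Matrix ν ν ℂ}

theorem GradedNormal.one_mem_spectrum {mult : ℕ} (h : GradedNormal A Z mult) (hm : 1 ≤ mult) :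
    1 ∈ spectrum ℂ (transfer A) := by
  rw [mem_spectrum_iff_isRoot_charpoly,
    ← Polynomial.rootMultiplicity_pos (transfer A).charpoly_monic.ne_zero, h.2.1]
  exact hm

theorem eq_zero_of_forall_list_prod_mulVec (hZ : IsParityMatrix Z) (hE : EvenTensor p A Z)
    (h : GradedIrreducible A Z) (h1 : 1 ∈ spectrum ℂ (transfer A)) (k : ℕ) (z : ν → ℂ)
    (hz : ∀ l : List ι, l.length = k → (l.map A).prod *ᵥ z = 0) : z = 0 := by
  let M : Submodule ℂ (ν → ℂ) :=
    ⨅ (l : List ι) (_ : k ≤ l.length), LinearMap.ker (Matrix.toLin' (l.map A).prod)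
  have hM : ∀ x, x ∈ M ↔ ∀ l : List ι, k ≤ l.length → (l.map A).prod *ᵥ x = 0 := fun x => by
    simp [M, Submodule.mem_iInf]
  have hzM : z ∈ M := (hM z).2 fun l hl => by
    rw [← List.take_append_drop (l.length - k) l, List.map_append, List.prod_append,
      ← mulVec_mulVec, hz _ (by simp; omega), mulVec_zero]
  rcases h.eq_bot_or_eq_top hZ M (fun i x hx => (hM _).2 fun l hl => by
    have := (hM x).1 hx (l ++ [i]) (by simp; omega)
    rwa [List.map_append, List.prod_append, List.map_singleton, List.prod_singleton,
      ← mulVec_mulVec] at this) (fun x hx => (hM _).2 fun l hl => by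
    obtain ⟨s, hs, h⟩ := list_prod_mul_parity hE l
    have h2 : s • ((l.map A).prod *ᵥ (Z *ᵥ x)) = 0 := by
      rw [mulVec_mulVec, ← smul_mulVec, ← h, ← mulVec_mulVec, (hM x).1 hx l hl, mulVec_zero]
    exact (smul_eq_zero.1 h2).resolve_left hs) with hb | ht
  · rwa [hb, Submodule.mem_bot] at hzM
  · obtain ⟨l, hl, hl0⟩ := exists_list_prod_ne_zero h1 k
    refine absurd (Matrix.ext_of_mulVec_single fun i => ?_) hl0
    rw [(hM _).1 (ht ▸ Submodule.mem_top) l hl.ge, zero_mulVec]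

theorem eq_zero_of_forall_vecMul_list_prod (hZ : IsParityMatrix Z) (hE : EvenTensor p A Z)
    (h : GradedIrreducible A Z) (h1 : 1 ∈ spectrum ℂ (transfer A)) (k : ℕ) (y : ν → ℂ)
    (hy : ∀ l : List ι, l.length = k → y ᵥ* (l.map A).prod = 0) : y = 0 := by
  let Y : Set (ν → ℂ) := {y | ∀ l : List ι, k ≤ l.length → y ᵥ* (l.map A).prod = 0}
  have hyY : y ∈ Y := fun l hl => by
    rw [← List.take_append_drop k l, List.map_append, List.prod_append,
      ← vecMul_vecMul, hy _ (by simpa using hl), zero_vecMul]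
  let M : Submodule ℂ (ν → ℂ) :=
    { carrier := {x | ∀ y ∈ Y, y ⬝ᵥ x = 0}
      add_mem' := fun {a b} ha hb y hy => by rw [dotProduct_add, ha y hy, hb y hy, add_zero]
      zero_mem' := fun y _ => dotProduct_zero y
      smul_mem' := fun c x hx y hy => by rw [dotProduct_smul, hx y hy, smul_zero] }
  rcases h.eq_bot_or_eq_top hZ M (fun i x hx y hy => by
    rw [dotProduct_mulVec]
    refine hx _ fun l hl => ?_
    rw [vecMul_vecMul, ← List.prod_cons, ← List.map_cons]
    exact hy _ (by simp; omega)) (fun x hx y hy => by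
    rw [dotProduct_mulVec]
    refine hx _ fun l hl => ?_
    obtain ⟨s, hs, h⟩ := list_prod_mul_parity hE l
    rw [vecMul_vecMul, h, vecMul_smul, ← vecMul_vecMul, hy l hl, zero_vecMul, smul_zero])
    with hb | ht
  · obtain ⟨l, hl, hl0⟩ := exists_list_prod_ne_zero h1 k
    refine absurd (Matrix.ext_of_mulVec_single fun i => ?_) hl0
    rw [zero_mulVec, ← Submodule.mem_bot ℂ, ← hb]
    intro y hy
    rw [dotProduct_mulVec, hy l hl.ge, zero_dotProduct]
  · refine dotProduct_eq_zero_iff.1 fun x => ?_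
    exact (ht ▸ Submodule.mem_top : x ∈ M) y hyY

end block

theorem GCF.exists_matrix {ι ν : Type*} [Fintype ι] [Fintype ν] [DecidableEq ν]
    {p : ι → ZMod 2} {A : ι → Matrix ν ν ℂ} {Z : Matrix ν ν ℂ} (h : GCF p A Z) :
    ∃ Q : Matrix ν ν ℂ, (∀ i, Q * A i = 0 ∧ A i * Q = 0) ∧ ∀ k : ℕ,
      (∀ z, Q *ᵥ z = 0 → (∀ l : List ι, l.length = k → (l.map A).prod *ᵥ z = 0) → z = 0) ∧
      ∀ y, y ᵥ* Q = 0 → (∀ l : List ι, l.length = k → y ᵥ* (l.map A).prod = 0) → y = 0 := by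
  obtain ⟨g, Dk, e, μ, Ak, Zk, -, hA, -, hk⟩ := h
  let φ := reindexAlgEquiv ℂ ℂ e
  have hφ : ∀ M, φ M = reindex e e M := fun M => rfl
  have hw : ∀ l : List ι, φ (l.map A).prod =
      blockDiagonal' fun k => μ k ^ l.length • (l.map (Ak k)).prod := by
    intro l
    induction l with
    | nil =>
      simp only [List.map_nil, List.prod_nil, map_one, List.length_nil, pow_zero, one_smul]
      exact (blockDiagonal'_one (m' := fun k => Fin (Dk k)) (α := ℂ)).symm
    | cons i l ih =>
      rw [List.map_cons, List.prod_cons, map_mul, ih, hφ, hA, ← blockDiagonal'_mul]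
      congr 1
      ext1 k
      rw [smul_mul_smul_comm, List.map_cons, List.prod_cons, List.length_cons, pow_succ']
  let Q' : Matrix ((k : Fin g) × Fin (Dk k)) ((k : Fin g) × Fin (Dk k)) ℂ :=
    blockDiagonal' fun k => if μ k = 0 then 1 else 0
  have h1 : ∀ k, 1 ∈ spectrum ℂ (transfer (Ak k)) := fun k =>
    (hk k).2.2.elim (fun h => h.one_mem_spectrum le_rfl) fun h => h.one_mem_spectrum (by norm_num)
  have hirr : ∀ k, GradedIrreducible (Ak k) (Zk k) := fun k => (hk k).2.2.elim (·.1) (·.1)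
  have hmv : ∀ (M : (k : Fin g) → Matrix (Fin (Dk k)) (Fin (Dk k)) ℂ) (B : Matrix ν ν ℂ) (z : ν → ℂ),
      φ B = blockDiagonal' M → B *ᵥ z = 0 → ∀ k, M k *ᵥ (fun i => z (e.symm ⟨k, i⟩)) = 0 := by
    intro M B z hB hz k
    ext i
    have h2 := congrFun hz (e.symm ⟨k, i⟩)
    have h3 : ∀ x, B (e.symm ⟨k, i⟩) (e.symm x) = blockDiagonal' M ⟨k, i⟩ x := fun x => by
      rw [← hB]; rfl
    rw [mulVec, dotProduct, ← e.symm.sum_comp, Fintype.sum_sigma, Finset.sum_eq_single k] at h2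
    · simpa [h3, mulVec, dotProduct, blockDiagonal'_apply_eq] using h2
    · intro k' _ hk'
      exact Finset.sum_eq_zero fun j _ => by
        rw [h3, blockDiagonal'_apply_ne _ _ _ (Ne.symm hk'), zero_mul]
    · simp
  have hvm : ∀ (M : (k : Fin g) → Matrix (Fin (Dk k)) (Fin (Dk k)) ℂ) (B : Matrix ν ν ℂ) (z : ν → ℂ),
      φ B = blockDiagonal' M → z ᵥ* B = 0 → ∀ k, (fun i => z (e.symm ⟨k, i⟩)) ᵥ* M k = 0 := by
    intro M B z hB hz k
    rw [← mulVec_transpose] at hz ⊢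
    refine hmv (fun k => (M k)ᵀ) Bᵀ z ?_ hz k
    rw [← blockDiagonal'_transpose, ← hB]; rfl
  refine ⟨φ.symm Q', fun i => ⟨?_, ?_⟩, fun k => ⟨fun z hz hl => ?_, fun y hy hl => ?_⟩⟩
  · apply φ.injective
    rw [map_mul, φ.apply_symm_apply, hφ (A i), hA, map_zero, ← blockDiagonal'_mul,
      ← blockDiagonal'_zero]
    congr 1
    ext1 k
    by_cases h : μ k = 0 <;> simp [h]
  · apply φ.injective
    rw [map_mul, φ.apply_symm_apply, hφ (A i), hA, map_zero, ← blockDiagonal'_mul,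
      ← blockDiagonal'_zero]
    congr 1
    ext1 k
    by_cases h : μ k = 0 <;> simp [h]
  · have hb : ∀ j, (fun i => z (e.symm ⟨j, i⟩)) = 0 := by
      intro j
      by_cases hμ : μ j = 0
      · simpa [hμ] using hmv _ _ z (φ.apply_symm_apply Q') hz j
      · refine eq_zero_of_forall_list_prod_mulVec (hk j).1 (hk j).2.1 (hirr j) (h1 j) k _
          fun l hlk => ?_
        have := hmv _ _ z (hw l) (hl l hlk) j
        rw [smul_mulVec] at this
        exact (smul_eq_zero.1 this).resolve_left (pow_ne_zero _ hμ)
    ext i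
    obtain ⟨⟨j, i⟩, rfl⟩ := e.symm.surjective i
    exact congrFun (hb j) i
  · have hb : ∀ j, (fun i => y (e.symm ⟨j, i⟩)) = 0 := by
      intro j
      by_cases hμ : μ j = 0
      · simpa [hμ] using hvm _ _ y (φ.apply_symm_apply Q') hy j
      · refine eq_zero_of_forall_vecMul_list_prod (hk j).1 (hk j).2.1 (hirr j) (h1 j) k _
          fun l hlk => ?_
        have := hvm _ _ y (hw l) (hl l hlk) j
        rw [vecMul_smul] at this
        exact (smul_eq_zero.1 this).resolve_left (pow_ne_zero _ hμ)
    ext i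
    obtain ⟨⟨j, i⟩, rfl⟩ := e.symm.surjective i
    exact congrFun (hb j) i

theorem vecMul_pauliX_pow_kronecker {β γ : Type*} [Fintype β] (j : ℕ) (B : Matrix β γ ℂ)
    (y : β → ℂ) :
    (fun i : Bool × β => y i.2) ᵥ* ((pauliX ^ j) ⊗ₖ B) = fun i : Bool × γ => (y ᵥ* B) i.2 := by
  have h : ∀ j : ℕ, ∀ t, ∑ s, (pauliX ^ j) s t = 1 := by
    intro j
    induction j with
    | zero => intro t; simp [one_apply]
    | succ j ih =>
      intro t
      simp_rw [pow_succ', mul_apply]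
      rw [Finset.sum_comm]
      simp_rw [← Finset.sum_mul]
      have : ∀ u, ∑ s, pauliX s u = 1 := by intro u; cases u <;> simp [pauliX]
      simp only [this, one_mul, ih]
  ext ⟨t, i⟩
  simp only [vecMul, dotProduct, kroneckerMap_apply, Fintype.sum_prod_type]
  rw [Finset.sum_comm]
  refine Finset.sum_congr rfl fun a _ => ?_
  rw [← Finset.mul_sum, ← Finset.sum_mul, h, one_mul]

theorem pauliX_pow_kronecker_mulVec {β γ : Type*} [Fintype β] (j : ℕ) (B : Matrix γ β ℂ)
    (y : β → ℂ) :
    ((pauliX ^ j) ⊗ₖ B) *ᵥ (fun i : Bool × β => y i.2) = fun i : Bool × γ => (B *ᵥ y) i.2 := by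
  have hX : pauliXᵀ = pauliX := by ext a b; simp [pauliX, eq_comm]
  rw [← vecMul_transpose B, ← vecMul_pauliX_pow_kronecker j, ← vecMul_transpose,
    ← kroneckerMap_transpose, transpose_pow, hX]

section

variable {d b : ℕ} {p : Fin d → ZMod 2}
  {U : Fin d → Fin d → Matrix (Bool × Fin b) (Bool × Fin b) ℂ} {Z : Matrix _ _ ℂ} {c : ℂ}
  {N : Fin d → Fin d → Matrix (Fin b) (Fin b) ℂ}

theorem vecMul_word_lift (hN : ∀ n m, U n m = (pauliX ^ (p n + p m).val) ⊗ₖ N n m)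
    (l : List (Fin d × Fin d)) (y : Fin b → ℂ) :
    (fun i : Bool × Fin b => y i.2) ᵥ* (l.map (mpoScaled c U)).prod =
      c ^ l.length • fun i : Bool × Fin b => (y ᵥ* (l.map (doubledT N)).prod) i.2 := by
  induction l generalizing y with
  | nil => simp
  | cons i l ih =>
    rw [List.map_cons, List.prod_cons, ← vecMul_vecMul, mpoScaled, hN, vecMul_smul,
      vecMul_pauliX_pow_kronecker, smul_vecMul, ih, smul_smul, List.length_cons, pow_succ',
      List.map_cons, List.prod_cons, ← vecMul_vecMul, doubledT]

theorem mulVec_word_lift (hN : ∀ n m, U n m = (pauliX ^ (p n + p m).val) ⊗ₖ N n m)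
    (l : List (Fin d × Fin d)) (y : Fin b → ℂ) :
    (l.map (mpoScaled c U)).prod *ᵥ (fun i : Bool × Fin b => y i.2) =
      c ^ l.length • fun i : Bool × Fin b => ((l.map (doubledT N)).prod *ᵥ y) i.2 := by
  induction l with
  | nil => simp
  | cons i l ih =>
    rw [List.map_cons, List.prod_cons, ← mulVec_mulVec, ih, mulVec_smul, mpoScaled, hN, smul_mulVec,
      pauliX_pow_kronecker_mulVec, smul_smul, List.length_cons, pow_succ,
      List.map_cons, List.prod_cons, ← mulVec_mulVec, doubledT]

theorem sum_vecMul_eq_zero_of_word (hc : c ≠ 0)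
    (hN : ∀ n m, U n m = (pauliX ^ (p n + p m).val) ⊗ₖ N n m)
    (hGCF : GCF (doubledP p) (mpoScaled c U) Z) (k : ℕ) (x : Fin d × Fin d → Fin b → ℂ)
    (h : ∀ l : List (Fin d × Fin d), l.length = k →
      (∑ i, x i ᵥ* doubledT N i) ᵥ* (l.map (doubledT N)).prod = 0) :
    ∑ i, x i ᵥ* doubledT N i = 0 := by
  obtain ⟨Q, hQ, hk⟩ := hGCF.exists_matrix
  have h1 : (fun i : Bool × Fin b => (∑ j, x j ᵥ* doubledT N j) i.2) =
      c⁻¹ • ∑ j, (fun i : Bool × Fin b => x j i.2) ᵥ* mpoScaled c U j := by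
    have := fun j => vecMul_word_lift (c := c) hN [j] (x j)
    simp only [List.map_cons, List.map_nil, List.prod_cons, List.prod_nil, mul_one,
      List.length_cons, List.length_nil, zero_add, pow_one] at this
    simp_rw [this]
    rw [← Finset.smul_sum, smul_smul, inv_mul_cancel₀ hc, one_smul]
    ext i
    simp
  have h2 := (hk k).2 (fun i : Bool × Fin b => (∑ j, x j ᵥ* doubledT N j) i.2)
    (by
      rw [h1, smul_vecMul, sum_vecMul]
      simp [vecMul_vecMul, hQ])
    (fun l hl => by
      rw [vecMul_word_lift hN, h l hl]
      ext; simp)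
  ext i
  exact congrFun h2 (true, i)

theorem sum_mulVec_eq_zero_of_word (hc : c ≠ 0)
    (hN : ∀ n m, U n m = (pauliX ^ (p n + p m).val) ⊗ₖ N n m)
    (hGCF : GCF (doubledP p) (mpoScaled c U) Z) (k : ℕ) (x : Fin d × Fin d → Fin b → ℂ)
    (h : ∀ l : List (Fin d × Fin d), l.length = k →
      (l.map (doubledT N)).prod *ᵥ (∑ i, doubledT N i *ᵥ x i) = 0) :
    ∑ i, doubledT N i *ᵥ x i = 0 := by
  obtain ⟨Q, hQ, hk⟩ := hGCF.exists_matrix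
  have h1 : (fun i : Bool × Fin b => (∑ j, doubledT N j *ᵥ x j) i.2) =
      c⁻¹ • ∑ j, mpoScaled c U j *ᵥ (fun i : Bool × Fin b => x j i.2) := by
    have := fun j => mulVec_word_lift (c := c) hN [j] (x j)
    simp only [List.map_cons, List.map_nil, List.prod_cons, List.prod_nil, mul_one,
      List.length_cons, List.length_nil, zero_add, pow_one] at this
    simp_rw [this]
    rw [← Finset.smul_sum, smul_smul, inv_mul_cancel₀ hc, one_smul]
    ext i
    simp
  have h2 := (hk k).1 (fun i : Bool × Fin b => (∑ j, doubledT N j *ᵥ x j) i.2)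
    (by
      rw [h1, mulVec_smul, mulVec_sum]
      simp [mulVec_mulVec, hQ])
    (fun l hl => by
      rw [mulVec_word_lift hN, h l hl]
      ext; simp)
  ext i
  exact congrFun h2 (true, i)

end

theorem sgn_add (x y : ZMod 2) : sgn (x + y) = sgn x * sgn y := by
  have h : ∀ x : ZMod 2, x = 0 ∨ x = 1 := by decide
  have h0 : sgn 0 = 1 := by simp [sgn]
  have h1 : sgn 1 = -1 := by simp [sgn, ZMod.val_one]
  rcases h x with rfl | rfl <;> rcases h y with rfl | rfl <;>
    simp [h0, h1, CharTwo.add_self_eq_zero]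

theorem sgn_zero : sgn 0 = 1 := by simp [sgn]

theorem sgn_mul_self (x : ZMod 2) : sgn x * sgn x = 1 := by
  rw [← sgn_add, CharTwo.add_self_eq_zero, sgn_zero]

theorem sgn_ne_zero (x : ZMod 2) : sgn x ≠ 0 := pow_ne_zero _ (by norm_num)

theorem star_sgn (x : ZMod 2) : starRingEnd ℂ (sgn x) = sgn x := by simp [sgn]

/-- The parity of a configuration of sites. -/
def totalParity {ι : Type*} (p : ι → ZMod 2) (q : ℕ) (n : Fin q → ι) : ZMod 2 := ∑ j, p (n j)

theorem totalParity_append {ι : Type*} (p : ι → ZMod 2) {q r : ℕ} (n : Fin q → ι) (n' : Fin r → ι) :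
    totalParity p (q + r) (Fin.append n n') = totalParity p q n + totalParity p r n' := by
  simp [totalParity, Fin.sum_univ_add]

theorem blockSign_eq_sum {ι : Type*} (p : ι → ZMod 2) {q : ℕ} (n m : Fin q → ι) :
    blockSign p n m =
      ∑ j, ∑ l, if j < l then p (m j) * (p (n l) + p (m l)) else 0 := by
  rw [blockSign, Finset.sum_filter, Fintype.sum_prod_type]

theorem mpoSign_eq_blockSign {ι : Type*} (p : ι → ZMod 2) {q : ℕ} (n m : Fin q → ι) :
    mpoSign p n m = blockSign p n m := by
  rw [blockSign_eq_sum, mpoSign, Finset.sum_filter, Fintype.sum_prod_type_right]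
  simp only [mul_comm]

theorem blockSign_append {ι : Type*} (p : ι → ZMod 2) {q r : ℕ} (n m : Fin q → ι)
    (n' m' : Fin r → ι) :
    blockSign p (Fin.append n n') (Fin.append m m') =
      blockSign p n m + blockSign p n' m' +
        totalParity p q m * (totalParity p r n' + totalParity p r m') := by
  have h1 : ∀ (i : Fin q) (j : Fin r), Fin.castAdd r i < Fin.natAdd q j := fun i j =>
    Fin.lt_def.2 (by simp; omega)
  have h2 : ∀ (i : Fin q) (j : Fin r), ¬ Fin.natAdd q j < Fin.castAdd r i := fun i j =>
    (h1 i j).asymm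
  have h3 : ∀ i j : Fin q, Fin.castAdd r i < Fin.castAdd r j ↔ i < j := fun i j => Iff.rfl
  have h4 : ∀ i j : Fin r, Fin.natAdd q i < Fin.natAdd q j ↔ i < j := fun i j =>
    Fin.lt_def.trans ((Nat.add_lt_add_iff_left).trans Fin.lt_def.symm)
  simp only [blockSign_eq_sum, Fin.sum_univ_add, Fin.append_left, Fin.append_right, h1, h2,
    if_true, if_false, Finset.sum_const_zero, Finset.sum_add_distrib,
    h3, h4, totalParity]
  rw [← Finset.sum_add_distrib, Finset.sum_mul_sum]
  ring

/-- The fermionic composition of two MPO tensors on adjacent sites. -/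
def compMPO {ι κ β : Type*} [Fintype β] (p : ι → ZMod 2) (p' : κ → ZMod 2)
    (B : ι → ι → Matrix β β ℂ) (B' : κ → κ → Matrix β β ℂ) :
    ι × κ → ι × κ → Matrix β β ℂ :=
  fun n m => sgn (p m.1 * (p' n.2 + p' m.2)) • (B n.1 m.1 * B' n.2 m.2)

/-- The parity of a pair of sites. -/
def pairParity {ι κ : Type*} (p : ι → ZMod 2) (p' : κ → ZMod 2) : ι × κ → ZMod 2 :=
  fun n => p n.1 + p' n.2

theorem blocked_append {ι ν : Type*} [Fintype ν] [DecidableEq ν] (p : ι → ZMod 2)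
    (N : ι → ι → Matrix ν ν ℂ) {q r : ℕ} (n m : (Fin q → ι) × (Fin r → ι)) :
    blocked p N (q + r) (Fin.append n.1 n.2) (Fin.append m.1 m.2) =
      compMPO (totalParity p q) (totalParity p r) (blocked p N q) (blocked p N r) n m := by
  simp only [blocked, compMPO, blockSign_append, sgn_add, smul_mul_smul_comm, smul_smul]
  rw [List.ofFn_add, List.prod_append]
  congr 1
  · ring
  · simp

theorem blocked_one {ι ν : Type*} [Fintype ν] [DecidableEq ν] (p : ι → ZMod 2)
    (N : ι → ι → Matrix ν ν ℂ) (n m : Fin 1 → ι) : blocked p N 1 n m = N (n 0) (m 0) := by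
  simp [blocked, blockSign_eq_sum, sgn_zero]

theorem blocked_eq_smul_prod {ι ν : Type*} [Fintype ν] [DecidableEq ν] (p : ι → ZMod 2)
    (N : ι → ι → Matrix ν ν ℂ) (q : ℕ) (n m : Fin q → ι) :
    blocked p N q n m = sgn (blockSign p n m) •
      ((List.ofFn fun j => (n j, m j)).map (doubledT N)).prod := by
  rw [blocked, List.map_ofFn]; rfl

/-- The composition of the adjoint of an MPO tensor with the tensor itself, graded by the parity
of the physical legs that have been contracted. -/
def dbl {ι β : Type*} [Fintype ι] (p : ι → ZMod 2) (B : ι → ι → Matrix β β ℂ) (m m' : ι) :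
    Matrix (ZMod 2 × β × β) (ZMod 2 × β × β) ℂ :=
  Matrix.of fun r c => if c.1 = r.1 + p m + p m' then
    ∑ n, sgn (r.1 * (p n + p m)) * (starRingEnd ℂ (B n m r.2.1 c.2.1) * B n m' r.2.2 c.2.2) else 0

theorem sum_sum_comm {ι κ β γ M : Type*} [Fintype ι] [Fintype κ] [Fintype β] [Fintype γ]
    [AddCommMonoid M] (f : β → γ → ι → κ → M) :
    ∑ b, ∑ c, ∑ i, ∑ j, f b c i j = ∑ i, ∑ j, ∑ b, ∑ c, f b c i j := by
  have h1 := Finset.sum_comm (s := (Finset.univ : Finset (β × γ)))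
    (t := (Finset.univ : Finset (ι × κ))) (f := fun x y => f x.1 x.2 y.1 y.2)
  simpa only [Fintype.sum_prod_type] using h1

theorem dbl_mul {ι κ β : Type*} [Fintype ι] [Fintype κ] [Fintype β] (p : ι → ZMod 2)
    (p' : κ → ZMod 2) (B : ι → ι → Matrix β β ℂ) (B' : κ → κ → Matrix β β ℂ) (m₁ m₁' : ι)
    (m₂ m₂' : κ) :
    dbl p B m₁ m₁' * dbl p' B' m₂ m₂' = sgn ((p' m₂ + p' m₂') * p m₁') •
      dbl (pairParity p p') (compMPO p p' B B') (m₁, m₂) (m₁', m₂') := by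
  ext ⟨s, α, α'⟩ ⟨u, γ, γ'⟩
  simp only [mul_apply, dbl, of_apply, Matrix.smul_apply, Fintype.sum_prod_type, pairParity, compMPO,
    smul_eq_mul]
  rw [Finset.sum_eq_single (s + p m₁ + p m₁') (by
    intro t _ ht
    simp [ht]) (by simp)]
  have hu : s + p m₁ + p m₁' + p' m₂ + p' m₂' = s + (p m₁ + p' m₂) + (p m₁' + p' m₂') := by ring
  simp only [if_true, hu]
  split_ifs with h
  swap
  · simp
  simp only [Finset.sum_mul_sum]
  rw [sum_sum_comm, Finset.mul_sum]
  refine Finset.sum_congr rfl fun n₁ _ => ?_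
  rw [Finset.mul_sum]
  refine Finset.sum_congr rfl fun n₂ _ => ?_
  have hs : sgn (s * (p n₁ + p m₁)) * sgn ((s + p m₁ + p m₁') * (p' n₂ + p' m₂)) =
      sgn ((p' m₂ + p' m₂') * p m₁') * sgn (s * (p n₁ + p' n₂ + (p m₁ + p' m₂))) *
        sgn (p m₁ * (p' n₂ + p' m₂)) * sgn (p m₁' * (p' n₂ + p' m₂')) := by
    simp only [← sgn_add]
    congr 1
    linear_combination (- p m₁' * p' m₂') * (CharTwo.two_eq_zero : (2 : ZMod 2) = 0)
  simp only [map_mul, map_sum, star_sgn]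
  rw [mul_mul_mul_comm (sgn (p m₁ * _)), Finset.sum_mul_sum, ← mul_assoc, ← mul_assoc,
    ← mul_assoc, ← hs, Finset.mul_sum]
  refine Finset.sum_congr rfl fun b _ => ?_
  rw [Finset.mul_sum]
  refine Finset.sum_congr rfl fun b' _ => ?_
  ring

theorem dbl_blocked_append {ι β : Type*} [Fintype ι] [Fintype β] [DecidableEq β] (p : ι → ZMod 2)
    (N : ι → ι → Matrix β β ℂ) {q r : ℕ} (m₁ m₁' : Fin q → ι) (m₂ m₂' : Fin r → ι) :
    dbl (totalParity p (q + r)) (blocked p N (q + r)) (Fin.append m₁ m₂) (Fin.append m₁' m₂') =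
      dbl (pairParity (totalParity p q) (totalParity p r))
        (compMPO (totalParity p q) (totalParity p r) (blocked p N q) (blocked p N r))
        (m₁, m₂) (m₁', m₂') := by
  ext i c
  simp only [dbl, of_apply, ← (Fin.appendEquiv q r).sum_comp]
  simp only [Fin.appendEquiv, Equiv.coe_fn_mk, totalParity_append, pairParity]
  congr 1
  refine Finset.sum_congr rfl fun n _ => ?_
  rw [blocked_append p N n (m₁, m₂), blocked_append p N n (m₁', m₂')]

theorem dbl_blocked_one {ι β : Type*} [Fintype ι] [Fintype β] [DecidableEq β] (p : ι → ZMod 2)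
    (N : ι → ι → Matrix β β ℂ) (m m' : Fin 1 → ι) :
    dbl (totalParity p 1) (blocked p N 1) m m' = dbl p N (m 0) (m' 0) := by
  ext r c
  simp only [dbl, of_apply, ← (Equiv.funUnique (Fin 1) ι).symm.sum_comp, blocked_one, totalParity]
  simp

theorem dbl_blocked_zero {ι β : Type*} [Fintype ι] [Fintype β] [DecidableEq β] (p : ι → ZMod 2)
    (N : ι → ι → Matrix β β ℂ) (m m' : Fin 0 → ι) :
    dbl (totalParity p 0) (blocked p N 0) m m' = 1 := by
  ext ⟨s, a, a'⟩ ⟨t, c, c'⟩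
  simp only [dbl, of_apply, blocked, totalParity, one_apply, Prod.mk.injEq]
  by_cases h1 : s = t <;> by_cases h2 : a = c <;> by_cases h3 : a' = c' <;>
    simp [h1, h2, h3, sgn_zero, blockSign_eq_sum, one_apply, eq_comm]

theorem list_prod_dbl {ι β : Type*} [Fintype ι] [Fintype β] [DecidableEq β] (p : ι → ZMod 2)
    (N : ι → ι → Matrix β β ℂ) (q : ℕ) (m m' : Fin q → ι) :
    ∃ x : ZMod 2, (m = m' → x = 0) ∧
      ((List.ofFn fun j => (m j, m' j)).map fun i : ι × ι => dbl p N i.1 i.2).prod =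
        sgn x • dbl (totalParity p q) (blocked p N q) m m' := by
  induction q with
  | zero => exact ⟨0, fun _ => rfl, by simp [sgn_zero, dbl_blocked_zero]⟩
  | succ q ih =>
    obtain ⟨x, hx, h⟩ := ih (fun i => m (Fin.castAdd 1 i)) (fun i => m' (Fin.castAdd 1 i))
    refine ⟨x + (totalParity p 1 (fun i => m (Fin.natAdd q i)) +
      totalParity p 1 (fun i => m' (Fin.natAdd q i))) *
      totalParity p q (fun i => m' (Fin.castAdd 1 i)), ?_, ?_⟩
    · rintro rfl
      rw [hx rfl, CharTwo.add_self_eq_zero, zero_mul, zero_add]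
    · rw [List.ofFn_add, List.map_append, List.prod_append]
      refine (congrArg (· * _) h).trans ?_
      have h1 := dbl_blocked_one p N (fun i => m (Fin.natAdd q i)) (fun i => m' (Fin.natAdd q i))
      simp only [List.ofFn_succ, List.ofFn_zero, List.map_cons, List.map_nil, List.prod_cons,
        List.prod_nil, mul_one]
      rw [← h1, smul_mul_assoc, dbl_mul, smul_smul, ← dbl_blocked_append, sgn_add,
        Fin.append_castAdd_natAdd, Fin.append_castAdd_natAdd]

theorem sum_sgn_mul (x : ZMod 2) : ∑ s, sgn (s * x) = if x = 0 then 2 else 0 := by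
  have h : ∀ x : ZMod 2, x = 0 ∨ x = 1 := by decide
  have h1 : sgn 1 = -1 := by simp [sgn, ZMod.val_one]
  rw [show (Finset.univ : Finset (ZMod 2)) = {0, 1} from rfl, Finset.sum_pair zero_ne_one]
  rcases h x with rfl | rfl
  · norm_num [sgn_zero]
  · norm_num [sgn_zero, h1]

theorem trace_dbl {ι β : Type*} [Fintype ι] [Fintype β] (p : ι → ZMod 2)
    (B : ι → ι → Matrix β β ℂ) (m m' : ι) :
    (dbl p B m m').trace = if p m = p m' then
      ∑ n, (if p n = p m then 2 else 0) * (starRingEnd ℂ (B n m).trace * (B n m').trace) else 0 := by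
  have hc := fun f : ZMod 2 → β → β → ι → ℂ =>
    Finset.sum_comm (s := (Finset.univ : Finset (ZMod 2 × β × β)))
    (t := (Finset.univ : Finset ι)) (f := fun x n => f x.1 x.2.1 x.2.2 n)
  simp only [Fintype.sum_prod_type] at hc
  have h : ∀ s : ZMod 2, s = s + p m + p m' ↔ p m = p m' := fun s => by
    rw [add_assoc, left_eq_add, CharTwo.add_eq_zero]
  have h' : ∀ n, (if p n = p m then (2 : ℂ) else 0) = ∑ s, sgn (s * (p n + p m)) := fun n => by
    simp only [sum_sgn_mul, CharTwo.add_eq_zero]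
  simp only [h', trace, diag_apply, dbl, of_apply, Fintype.sum_prod_type, h]
  split_ifs
  · rw [hc]
    refine Finset.sum_congr rfl fun n _ => ?_
    rw [Finset.sum_mul]
    refine Finset.sum_congr rfl fun s _ => ?_
    rw [map_sum, Finset.sum_mul_sum, Finset.mul_sum]
    exact Finset.sum_congr rfl fun a _ => (Finset.mul_sum _ _ _).symm
  · simp

theorem pauliX_mul_self : pauliX * pauliX = 1 := by
  ext a b; cases a <;> cases b <;> simp [pauliX, mul_apply]

theorem pauliX_pow_val_add (x y : ZMod 2) :
    pauliX ^ (x + y).val = pauliX ^ x.val * pauliX ^ y.val := by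
  have h : ∀ x : ZMod 2, x = 0 ∨ x = 1 := by decide
  rcases h x with rfl | rfl <;> rcases h y with rfl | rfl <;>
    simp [ZMod.val_one, CharTwo.add_self_eq_zero, pauliX_mul_self]

theorem trace_pauliX_pow_val (x : ZMod 2) :
    (pauliX ^ x.val).trace = if x = 0 then 2 else 0 := by
  have h : ∀ x : ZMod 2, x = 0 ∨ x = 1 := by decide
  rcases h x with rfl | rfl
  · simp
  · simp [ZMod.val_one, pauliX, trace]

section

variable {d b : ℕ} {p : Fin d → ZMod 2}
  {U : Fin d → Fin d → Matrix (Bool × Fin b) (Bool × Fin b) ℂ}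
  {N : Fin d → Fin d → Matrix (Fin b) (Fin b) ℂ}

theorem list_prod_kronecker (hN : ∀ n m, U n m = (pauliX ^ (p n + p m).val) ⊗ₖ N n m)
    (l : List (Fin d × Fin d)) :
    (l.map (doubledT U)).prod =
      (pauliX ^ ((l.map (doubledP p)).sum).val) ⊗ₖ (l.map (doubledT N)).prod := by
  induction l with
  | nil => simp
  | cons i l ih =>
    rw [List.map_cons, List.prod_cons, ih, doubledT, hN, ← mul_kronecker_mul, ← pauliX_pow_val_add]
    rfl

theorem blocked_kronecker (hN : ∀ n m, U n m = (pauliX ^ (p n + p m).val) ⊗ₖ N n m)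
    {q : ℕ} (n m : Fin q → Fin d) :
    blocked p U q n m =
      (pauliX ^ (totalParity p q n + totalParity p q m).val) ⊗ₖ blocked p N q n m := by
  rw [blocked_eq_smul_prod, blocked_eq_smul_prod, list_prod_kronecker hN, kronecker_smul,
    List.map_ofFn, List.sum_ofFn, totalParity, totalParity, ← Finset.sum_add_distrib]
  rfl

theorem fMPO_apply_eq (hN : ∀ n m, U n m = (pauliX ^ (p n + p m).val) ⊗ₖ N n m)
    {q : ℕ} (n m : Fin q → Fin d) :
    fMPO p U q n m = (if totalParity p q n = totalParity p q m then 2 else 0) *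
      (blocked p N q n m).trace := by
  have h : fMPO p U q n m = (blocked p U q n m).trace := by
    rw [fMPO, of_apply, mpoSign_eq_blockSign, blocked, trace_smul, smul_eq_mul]
  rw [h, blocked_kronecker hN, trace_kronecker, trace_pauliX_pow_val]
  simp only [CharTwo.add_eq_zero]

theorem sum_conj_fMPO {q : ℕ}
    (hU : ((Real.sqrt 2 : ℂ))⁻¹ • fMPO p U q ∈ Matrix.unitaryGroup (Fin q → Fin d) ℂ)
    (m m' : Fin q → Fin d) :
    ∑ n, starRingEnd ℂ (fMPO p U q n m) * fMPO p U q n m' = if m = m' then 2 else 0 := by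
  have h := congrFun (congrFun (mem_unitaryGroup_iff'.1 hU) m) m'
  have h2 : ((Real.sqrt 2 : ℂ))⁻¹ * ((Real.sqrt 2 : ℂ))⁻¹ = 2⁻¹ := by
    rw [← mul_inv, ← Complex.ofReal_mul, Real.mul_self_sqrt (by norm_num)]; norm_num
  rw [star_smul, smul_mul_smul_comm, star_inv₀, Complex.star_def, Complex.conj_ofReal, h2,
    Matrix.smul_apply, mul_apply, one_apply, smul_eq_mul, inv_mul_eq_iff_eq_mul₀ two_ne_zero] at h
  rw [mul_ite, mul_one, mul_zero] at h
  simpa [star_apply] using h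

theorem trace_dbl_blocked (hN : ∀ n m, U n m = (pauliX ^ (p n + p m).val) ⊗ₖ N n m) {q : ℕ}
    (hU : ((Real.sqrt 2 : ℂ))⁻¹ • fMPO p U q ∈ Matrix.unitaryGroup (Fin q → Fin d) ℂ)
    (m m' : Fin q → Fin d) :
    (dbl (totalParity p q) (blocked p N q) m m').trace = if m = m' then 1 else 0 := by
  have h := sum_conj_fMPO hU m m'
  rw [trace_dbl]
  by_cases hp : totalParity p q m = totalParity p q m'
  · rw [if_pos hp, ← mul_right_inj' (two_ne_zero (α := ℂ)), mul_ite, mul_one, mul_zero, ← h,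
      Finset.mul_sum]
    refine Finset.sum_congr rfl fun n _ => ?_
    rw [fMPO_apply_eq hN, fMPO_apply_eq hN, ← hp]
    split_ifs
    · rw [map_mul, map_ofNat]; ring
    · simp
  · rw [if_neg hp, if_neg]
    rintro rfl
    exact hp rfl

theorem trace_list_prod_dbl (hN : ∀ n m, U n m = (pauliX ^ (p n + p m).val) ⊗ₖ N n m)
    (hU : ∀ q : ℕ, 1 ≤ q →
      ((Real.sqrt 2 : ℂ))⁻¹ • fMPO p U q ∈ Matrix.unitaryGroup (Fin q → Fin d) ℂ)
    (l : List (Fin d × Fin d)) (hl : l ≠ []) :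
    (l.map fun i => dbl p N i.1 i.2).prod.trace =
      (l.map fun i => if i.1 = i.2 then (1 : ℂ) else 0).prod := by
  have hl' : l = List.ofFn fun j : Fin l.length => ((l.get j).1, (l.get j).2) :=
    (List.ofFn_get l).symm
  have hpos : 1 ≤ l.length := List.length_pos_iff.2 hl
  obtain ⟨x, hx, h⟩ := list_prod_dbl p N l.length (fun j => (l.get j).1) (fun j => (l.get j).2)
  rw [← hl'] at h
  rw [h, trace_smul, trace_dbl_blocked hN (hU _ hpos)]
  conv_rhs => rw [hl', List.map_ofFn, List.prod_ofFn]
  simp only [Function.comp_apply, Finset.prod_ite_zero, Finset.prod_const_one]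
  by_cases hm : (fun j => (l.get j).1) = fun j => (l.get j).2
  · rw [hx hm, if_pos hm, if_pos fun j _ => congrFun hm j, sgn_zero, one_smul]
  · rw [if_neg hm, if_neg fun h => hm (funext fun j => h j (Finset.mem_univ _)), smul_zero]

end

/-- The contraction of an MPO tensor with its conjugate over everything but the left bond. -/
def leftDens {ι β : Type*} [Fintype ι] [Fintype β] (B : ι → ι → Matrix β β ℂ) (a a' : β) : ℂ :=
  ∑ n, ∑ m, ∑ c, starRingEnd ℂ (B n m a c) * B n m a' c

/-- The contraction of an MPO tensor with its conjugate over everything but the right bond. -/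
def rightDens {ι β : Type*} [Fintype ι] [Fintype β] (B : ι → ι → Matrix β β ℂ) (c c' : β) : ℂ :=
  ∑ n, ∑ m, ∑ a, starRingEnd ℂ (B n m a c) * B n m a c'

theorem exists_eq_mul_dens {ι β : Type*} [Fintype ι] [Fintype β] (p : ι → ZMod 2)
    (B : ι → ι → Matrix β β ℂ) (z : ℂ) (x y : ZMod 2 × β × β → ℂ)
    (he : z • ∑ m, dbl p B m m = vecMulVec x y) (ht : (z • ∑ m, dbl p B m m).trace = 1) :
    ∃ c : ℂ, c ≠ 0 ∧ ∀ r t, (z • ∑ m, dbl p B m m) r t =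
      if r.1 = 0 ∧ t.1 = 0 then c * leftDens B r.2.1 r.2.2 * rightDens B t.2.1 t.2.2 else 0 := by
  have hz : z ≠ 0 := by rintro rfl; simp at ht
  have hent : ∀ r t : ZMod 2 × β × β, x r * y t = z * if t.1 = r.1 then ∑ n, ∑ m,
      sgn (r.1 * (p n + p m)) * (starRingEnd ℂ (B n m r.2.1 t.2.1) * B n m r.2.2 t.2.2) else 0 := by
    intro r t
    rw [← vecMulVec_apply, ← he, Matrix.smul_apply, Matrix.sum_apply, smul_eq_mul]
    simp only [dbl, of_apply, add_assoc, CharTwo.add_self_eq_zero, add_zero]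
    by_cases h : t.1 = r.1
    · simp only [h, if_true]; rw [Finset.sum_comm]
    · simp [h]
  have h00 : ∀ a a' c c' : β, x (0, a, a') * y (0, c, c') =
      z * ∑ n, ∑ m, starRingEnd ℂ (B n m a c) * B n m a' c' := fun a a' c c' => by
    simp [hent, sgn_zero]
  set S : ℂ := ∑ a, ∑ c, ∑ n, ∑ m, starRingEnd ℂ (B n m a c) * B n m a c with hS
  have hS0 : S ≠ 0 := by
    intro h0
    have hB : ∀ n m a c, B n m a c = 0 := by
      have h1 : S = ((∑ a, ∑ c, ∑ n, ∑ m, Complex.normSq (B n m a c) : ℝ) : ℂ) := by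
        rw [hS]; push_cast
        simp only [Complex.normSq_eq_conj_mul_self]
      rw [h1, Complex.ofReal_eq_zero] at h0
      intro n m a c
      have h2 := fun i => (Finset.sum_eq_zero_iff_of_nonneg (s := Finset.univ)
        (fun a _ => Finset.sum_nonneg fun c _ => Finset.sum_nonneg fun n _ =>
          Finset.sum_nonneg fun m _ => Complex.normSq_nonneg (B n m a c))).1 h0 i (Finset.mem_univ _)
      have h3 := (Finset.sum_eq_zero_iff_of_nonneg
        (fun c _ => Finset.sum_nonneg fun n _ =>
          Finset.sum_nonneg fun m _ => Complex.normSq_nonneg (B n m a c))).1 (h2 a) c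
          (Finset.mem_univ _)
      have h4 := (Finset.sum_eq_zero_iff_of_nonneg
        (fun n _ => Finset.sum_nonneg fun m _ => Complex.normSq_nonneg (B n m a c))).1 h3 n
          (Finset.mem_univ _)
      have h5 := (Finset.sum_eq_zero_iff_of_nonneg
        (fun m _ => Complex.normSq_nonneg (B n m a c))).1 h4 m (Finset.mem_univ _)
      exact Complex.normSq_eq_zero.1 h5
    rw [he, trace] at ht
    simp [vecMulVec_apply, hent, hB] at ht
  have hXY : (∑ a, x (0, a, a)) * ∑ c, y (0, c, c) = z * S := by
    rw [Finset.sum_mul_sum]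
    simp only [h00, hS, Finset.mul_sum]
  have hX0 : (∑ a, x (0, a, a)) ≠ 0 := fun h => mul_ne_zero hz hS0 (by rw [← hXY, h, zero_mul])
  have hY0 : (∑ c, y (0, c, c)) ≠ 0 := fun h => mul_ne_zero hz hS0 (by rw [← hXY, h, mul_zero])
  obtain ⟨a₀, -, ha₀⟩ := Finset.exists_ne_zero_of_sum_ne_zero hX0
  obtain ⟨c₀, -, hc₀⟩ := Finset.exists_ne_zero_of_sum_ne_zero hY0
  have hx1 : ∀ r : ZMod 2 × β × β, r.1 ≠ 0 → x r = 0 := fun r hr => by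
    have := hent r (0, c₀, c₀)
    rw [if_neg (Ne.symm hr), mul_zero] at this
    exact (mul_eq_zero.1 this).resolve_right hc₀
  have hy1 : ∀ r : ZMod 2 × β × β, r.1 ≠ 0 → y r = 0 := fun r hr => by
    have := hent (0, a₀, a₀) r
    rw [if_neg hr, mul_zero] at this
    exact (mul_eq_zero.1 this).resolve_left ha₀
  have hl : ∀ a a', x (0, a, a') * (∑ c, y (0, c, c)) = z * leftDens B a a' := fun a a' => by
    rw [Finset.mul_sum]
    simp only [h00, leftDens, Finset.mul_sum]
    rw [Finset.sum_comm]
    exact Finset.sum_congr rfl fun n _ => Finset.sum_comm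
  have hr : ∀ c c', (∑ a, x (0, a, a)) * y (0, c, c') = z * rightDens B c c' := fun c c' => by
    rw [Finset.sum_mul]
    simp only [h00, rightDens, Finset.mul_sum]
    rw [Finset.sum_comm]
    exact Finset.sum_congr rfl fun n _ => Finset.sum_comm
  refine ⟨z / S, div_ne_zero hz hS0, ?_⟩
  rw [he]
  rintro ⟨s, a, a'⟩ ⟨t, c, c'⟩
  rw [vecMulVec_apply]
  split_ifs with h
  · obtain ⟨rfl, rfl⟩ : s = 0 ∧ t = 0 := h
    have h1 : leftDens B a a' = x (0, a, a') * (∑ c, y (0, c, c)) / z := by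
      rw [hl, mul_div_cancel_left₀ _ hz]
    have h2 : rightDens B c c' = (∑ a, x (0, a, a)) * y (0, c, c') / z := by
      rw [hr, mul_div_cancel_left₀ _ hz]
    dsimp only
    rw [h1, h2]
    have : S = (∑ a, x (0, a, a)) * (∑ c, y (0, c, c)) / z := by
      rw [hXY, mul_div_cancel_left₀ _ hz]
    rw [this]
    field_simp
  · rcases not_and_or.1 h with h | h
    · rw [hx1 _ h, zero_mul]
    · rw [hy1 _ h, mul_zero]

theorem sum_dbl_pow {ι β : Type*} [Fintype ι] [Fintype β] [DecidableEq β] (p : ι → ZMod 2)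
    (N : ι → ι → Matrix β β ℂ) (q : ℕ) :
    (∑ m, dbl p N m m) ^ q =
      ∑ m : Fin q → ι, dbl (totalParity p q) (blocked p N q) m m := by
  induction q with
  | zero => simp [dbl_blocked_zero]
  | succ q ih =>
    rw [pow_succ, ih, ← (Fin.appendEquiv q 1).sum_comp, Fintype.sum_prod_type, Finset.sum_mul]
    refine Finset.sum_congr rfl fun m₁ _ => ?_
    rw [Finset.mul_sum, ← (Equiv.funUnique (Fin 1) ι).sum_comp]
    refine Finset.sum_congr rfl fun m₂ _ => ?_
    have h := dbl_mul (totalParity p q) (totalParity p 1) (blocked p N q) (blocked p N 1)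
      m₁ m₁ m₂ m₂
    rw [CharTwo.add_self_eq_zero, zero_mul, sgn_zero, one_smul, ← dbl_blocked_append,
      dbl_blocked_one] at h
    exact h

theorem exists_dbl_mul_dbl_eq {d b : ℕ} {p : Fin d → ZMod 2}
    {U : Fin d → Fin d → Matrix (Bool × Fin b) (Bool × Fin b) ℂ}
    {N : Fin d → Fin d → Matrix (Fin b) (Fin b) ℂ} (hd : 1 ≤ d)
    (hN : ∀ n m, U n m = (pauliX ^ (p n + p m).val) ⊗ₖ N n m)
    (hU : ∀ q : ℕ, 1 ≤ q →
      ((Real.sqrt 2 : ℂ))⁻¹ • fMPO p U q ∈ Matrix.unitaryGroup (Fin q → Fin d) ℂ) :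
    ∃ k : ℕ, 1 ≤ k ∧ ∃ c : ℂ, c ≠ 0 ∧ ∀ q₁ q₂ : ℕ, k ≤ q₁ → k ≤ q₂ →
      ∀ (m₁ m₁' : Fin q₁ → Fin d) (m₂ m₂' : Fin q₂ → Fin d) (r t : ZMod 2 × Fin b × Fin b),
      (dbl (totalParity p q₁) (blocked p N q₁) m₁ m₁' *
        dbl (totalParity p q₂) (blocked p N q₂) m₂ m₂') r t =
      c * (∑ a, ∑ a', dbl (totalParity p q₁) (blocked p N q₁) m₁ m₁' r (0, a, a') *
          leftDens (blocked p N k) a a') *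
        (∑ a, ∑ a', rightDens (blocked p N k) a a' *
          dbl (totalParity p q₂) (blocked p N q₂) m₂ m₂' (0, a, a') t) := by
  have hd0 : (d : ℂ) ≠ 0 := Nat.cast_ne_zero.2 (by omega)
  obtain ⟨k, hk, ht, ⟨x, y, he⟩, hfac⟩ := exists_factorization_of_trace_prod
    (fun i : Fin d × Fin d => dbl p N i.1 i.2) (fun i => if i.1 = i.2 then (1 : ℂ) else 0)
    (trace_list_prod_dbl hN hU) (fun i => if i.1 = i.2 then (d : ℂ)⁻¹ else 0)
    (by simp [Fintype.sum_prod_type, hd0])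
  have hE : (∑ i : Fin d × Fin d, (if i.1 = i.2 then (d : ℂ)⁻¹ else 0) • dbl p N i.1 i.2) ^ k =
      ((d : ℂ)⁻¹) ^ k • ∑ m, dbl (totalParity p k) (blocked p N k) m m := by
    rw [← sum_dbl_pow, ← smul_pow, Finset.smul_sum, Fintype.sum_prod_type]
    simp [ite_smul]
  rw [hE] at ht he hfac
  obtain ⟨c, hc, hcd⟩ := exists_eq_mul_dens _ _ _ x y he ht
  refine ⟨k, hk, c, hc, fun q₁ q₂ h₁ h₂ m₁ m₁' m₂ m₂' r t => ?_⟩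
  obtain ⟨x₁, -, hx₁⟩ := list_prod_dbl p N q₁ m₁ m₁'
  obtain ⟨x₂, -, hx₂⟩ := list_prod_dbl p N q₂ m₂ m₂'
  have h := hfac (List.ofFn fun j => (m₁ j, m₁' j)) (List.ofFn fun j => (m₂ j, m₂' j))
    (by simpa using h₁) (by simpa using h₂)
  rw [hx₁, hx₂, smul_mul_smul_comm, smul_mul_assoc, smul_mul_smul_comm] at h
  have h' := smul_right_injective _ (mul_ne_zero (sgn_ne_zero x₁) (sgn_ne_zero x₂)) h
  have hs : ∀ f : ZMod 2 × Fin b × Fin b → ℂ, (∀ i, i.1 ≠ 0 → f i = 0) →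
      ∑ i, f i = ∑ a, ∑ a', f (0, a, a') := fun f hf => by
    rw [Fintype.sum_prod_type, Finset.sum_eq_single 0 (fun s _ hs =>
      Finset.sum_eq_zero fun i _ => hf (s, i) hs) (by simp), Fintype.sum_prod_type]
  rw [h', mul_apply, hs]
  swap
  · intro i hi
    rw [mul_apply, Finset.sum_eq_zero, zero_mul]
    intro j _
    rw [hcd, if_neg (fun h => hi h.2), mul_zero]
  rw [Finset.mul_sum]
  refine Finset.sum_congr rfl fun a _ => ?_
  rw [Finset.mul_sum]
  refine Finset.sum_congr rfl fun a' _ => ?_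
  rw [← mul_assoc, mul_apply, hs]
  swap
  · intro i hi
    rw [hcd, if_neg (fun h => hi h.1), mul_zero]
  simp only [hcd, and_self, if_true]
  congr 1
  rw [Finset.mul_sum, Finset.sum_mul]
  refine Finset.sum_congr rfl fun e _ => ?_
  rw [Finset.mul_sum, Finset.sum_mul]
  refine Finset.sum_congr rfl fun e' _ => ?_
  ring

/-- The Gram matrix of an MPO tensor over its right bond, weighted by `ρ`, with left bond and
lower physical leg open. -/
def rightGram {ι β : Type*} [Fintype ι] [Fintype β] (p : ι → ZMod 2) (B : ι → ι → Matrix β β ℂ)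
    (ρ : β → β → ℂ) : Matrix (ι × β) (ι × β) ℂ :=
  Matrix.of fun r c => ∑ n, ∑ b, ∑ b', sgn (p n * (p r.1 + p c.1)) *
    (starRingEnd ℂ (B n r.1 r.2 b) * B n c.1 c.2 b' * ρ b b')

/-- The Gram matrix of an MPO tensor over its left bond, weighted by `ρ`, with right bond and
lower physical leg open. -/
def leftGram {ι β : Type*} [Fintype ι] [Fintype β] (B : ι → ι → Matrix β β ℂ)
    (ρ : β → β → ℂ) : Matrix (ι × β) (ι × β) ℂ :=
  Matrix.of fun r c => ∑ n, ∑ a, ∑ a',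
    (starRingEnd ℂ (B n r.1 a r.2) * B n c.1 a' c.2 * ρ a a')

theorem rank_rightGram {ι κ β : Type*} [Fintype ι] [Fintype κ] [Fintype β] (p : ι → ZMod 2)
    (B : ι → ι → Matrix β β ℂ) (W : κ → κ → Matrix β β ℂ)
    (h : ∀ n (v : ι → β → ℂ), (∀ w w', (∑ m, v m ᵥ* B n m) ᵥ* W w w' = 0) →
      ∑ m, v m ᵥ* B n m = 0) :
    (rightGram p B (leftDens W)).rank = rightRank p B := by
  set M : Matrix (ι × κ × κ × β) (ι × β) ℂ := Matrix.of fun r c =>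
    sgn (p r.1 * p c.1) * (B r.1 c.1 * W r.2.1 r.2.2.1) c.2 r.2.2.2 with hM
  have h1 : rightGram p B (leftDens W) = Mᴴ * M := by
    ext ⟨m, a⟩ ⟨m', a'⟩
    simp only [hM, rightGram, leftDens, mul_apply, of_apply, conjTranspose_apply,
      Fintype.sum_prod_type, Complex.star_def, map_mul, star_sgn, map_sum]
    refine Finset.sum_congr rfl fun n _ => ?_
    have hs := sum_sum_comm (ι := β) (κ := β) (β := κ × κ) (γ := β)
      fun w c x y => sgn (p n * p m) * sgn (p n * p m') *
        (starRingEnd ℂ (B n m a x) * starRingEnd ℂ (W w.1 w.2 x c) *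
          (B n m' a' y * W w.1 w.2 y c))
    simp only [Fintype.sum_prod_type] at hs
    refine Eq.trans ?_ (hs.symm.trans ?_)
    · simp only [Finset.mul_sum, mul_add, sgn_add]
      refine Finset.sum_congr rfl fun _ _ => Finset.sum_congr rfl fun _ _ =>
        Finset.sum_congr rfl fun _ _ => Finset.sum_congr rfl fun _ _ =>
        Finset.sum_congr rfl fun _ _ => by ring
    · refine Finset.sum_congr rfl fun _ _ => Finset.sum_congr rfl fun _ _ =>
        Finset.sum_congr rfl fun _ _ => ?_
      rw [mul_mul_mul_comm, Finset.sum_mul_sum]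
      simp only [Finset.mul_sum]
  rw [h1, rank_conjTranspose_mul_self, rightRank]
  refine rank_eq_of_ker _ _ fun x => ?_
  have hR : ∀ n b, ((Matrix.of fun (r c : ι × β) =>
      sgn (p r.1 * p c.1) * B r.1 c.1 c.2 r.2) *ᵥ x) (n, b) =
      (∑ m, (fun a => sgn (p n * p m) * x (m, a)) ᵥ* B n m) b := fun n b => by
    simp only [mulVec, vecMul, dotProduct, of_apply, Fintype.sum_prod_type, Finset.sum_apply]
    exact Finset.sum_congr rfl fun m _ => Finset.sum_congr rfl fun a _ => by ring
  have hL : ∀ n w w' c, (M *ᵥ x) (n, w, w', c) =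
      ((∑ m, (fun a => sgn (p n * p m) * x (m, a)) ᵥ* B n m) ᵥ* W w w') c := fun n w w' c => by
    rw [sum_vecMul]
    simp only [vecMul_vecMul, Finset.sum_apply]
    simp only [hM, mulVec, vecMul, dotProduct, of_apply, Fintype.sum_prod_type]
    exact Finset.sum_congr rfl fun m _ => Finset.sum_congr rfl fun a _ => by ring
  constructor
  · intro hx
    ext ⟨n, b⟩
    rw [hR, h n _ fun w w' => funext fun c => ?_]
    · rfl
    · rw [← hL, hx]; rfl
  · intro hx
    ext ⟨n, w, w', c⟩
    have : ∑ m, (fun a => sgn (p n * p m) * x (m, a)) ᵥ* B n m = 0 := funext fun b => by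
      rw [← hR, hx]; rfl
    rw [hL, this, zero_vecMul]; rfl

theorem rank_leftGram {ι κ β : Type*} [Fintype ι] [Fintype κ] [Fintype β]
    (B : ι → ι → Matrix β β ℂ) (W : κ → κ → Matrix β β ℂ)
    (h : ∀ n (v : ι → β → ℂ), (∀ w w', W w w' *ᵥ (∑ m, B n m *ᵥ v m) = 0) →
      ∑ m, B n m *ᵥ v m = 0) :
    (leftGram B (rightDens W)).rank = leftRank B := by
  set M : Matrix (ι × κ × κ × β) (ι × β) ℂ := Matrix.of fun r c =>
    (W r.2.1 r.2.2.1 * B r.1 c.1) r.2.2.2 c.2 with hM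
  have h1 : leftGram B (rightDens W) = Mᴴ * M := by
    ext ⟨m, a⟩ ⟨m', a'⟩
    simp only [hM, leftGram, rightDens, mul_apply, of_apply, conjTranspose_apply,
      Fintype.sum_prod_type, Complex.star_def, map_mul, map_sum]
    refine Finset.sum_congr rfl fun n _ => ?_
    have hs := sum_sum_comm (ι := β) (κ := β) (β := κ × κ) (γ := β)
      fun w c x y => starRingEnd ℂ (W w.1 w.2 c x) * starRingEnd ℂ (B n m x a) *
          (W w.1 w.2 c y * B n m' y a')
    simp only [Fintype.sum_prod_type] at hs
    refine Eq.trans ?_ (hs.symm.trans ?_)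
    · simp only [Finset.mul_sum]
      refine Finset.sum_congr rfl fun _ _ => Finset.sum_congr rfl fun _ _ =>
        Finset.sum_congr rfl fun _ _ => Finset.sum_congr rfl fun _ _ =>
        Finset.sum_congr rfl fun _ _ => by ring
    · refine Finset.sum_congr rfl fun _ _ => Finset.sum_congr rfl fun _ _ =>
        Finset.sum_congr rfl fun _ _ => ?_
      rw [Finset.sum_mul_sum]
  rw [h1, rank_conjTranspose_mul_self, leftRank]
  refine rank_eq_of_ker _ _ fun x => ?_
  have hR : ∀ n b, ((Matrix.of fun (r c : ι × β) => B r.1 c.1 r.2 c.2) *ᵥ x) (n, b) =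
      (∑ m, B n m *ᵥ fun a => x (m, a)) b := fun n b => by
    simp only [mulVec, dotProduct, of_apply, Fintype.sum_prod_type, Finset.sum_apply]
  have hL : ∀ n w w' c, (M *ᵥ x) (n, w, w', c) =
      (W w w' *ᵥ (∑ m, B n m *ᵥ fun a => x (m, a))) c := fun n w w' c => by
    rw [mulVec_sum]
    simp only [mulVec_mulVec, Finset.sum_apply]
    simp only [hM, mulVec, dotProduct, of_apply, Fintype.sum_prod_type]
  constructor
  · intro hx
    ext ⟨n, b⟩
    rw [hR, h n _ fun w w' => funext fun c => ?_]
    · rfl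
    · rw [← hL, hx]; rfl
  · intro hx
    ext ⟨n, w, w', c⟩
    have : ∑ m, B n m *ᵥ (fun a => x (m, a)) = 0 := funext fun b => by
      rw [← hR, hx]; rfl
    rw [hL, this, mulVec_zero]; rfl

section

variable {d b : ℕ} {p : Fin d → ZMod 2} {Z : Matrix (Bool × Fin b) (Bool × Fin b) ℂ} {c : ℂ}
  {U : Fin d → Fin d → Matrix (Bool × Fin b) (Bool × Fin b) ℂ}
  {N : Fin d → Fin d → Matrix (Fin b) (Fin b) ℂ}

theorem sum_vecMul_blocked_eq_zero (hc : c ≠ 0)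
    (hN : ∀ n m, U n m = (pauliX ^ (p n + p m).val) ⊗ₖ N n m)
    (hGCF : GCF (doubledP p) (mpoScaled c U) Z) (k : ℕ) {q : ℕ} (hq : 1 ≤ q)
    (n : Fin q → Fin d) (v : (Fin q → Fin d) → Fin b → ℂ)
    (h : ∀ w w', (∑ m, v m ᵥ* blocked p N q n m) ᵥ* blocked p N k w w' = 0) :
    ∑ m, v m ᵥ* blocked p N q n m = 0 := by
  obtain ⟨q, rfl⟩ : ∃ r, q = r + 1 := ⟨q - 1, by omega⟩
  set f : (Fin (q + 1) → Fin d) → Fin d × Fin d := fun m => (n (Fin.last q), m (Fin.last q))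
  have hsum : ∑ m, v m ᵥ* blocked p N (q + 1) n m =
      ∑ i, (∑ m with f m = i, v m ᵥ* (sgn (blockSign p n m) •
        (List.ofFn fun j : Fin q => N (n j.castSucc) (m j.castSucc)).prod)) ᵥ* doubledT N i := by
    rw [← Finset.sum_fiberwise (s := Finset.univ) (g := f)]
    refine Finset.sum_congr rfl fun i _ => ?_
    rw [sum_vecMul]
    refine Finset.sum_congr rfl fun m hm => ?_
    rw [← (Finset.mem_filter.1 hm).2, vecMul_vecMul, blocked, List.ofFn_succ', List.concat_eq_append,
      List.prod_append, List.prod_singleton, smul_mul_assoc]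
    rfl
  rw [hsum]
  refine sum_vecMul_eq_zero_of_word hc hN hGCF k _ fun l hl => ?_
  rw [← hsum]
  subst hl
  have h1 := h (fun j => (l.get j).1) (fun j => (l.get j).2)
  rw [blocked_eq_smul_prod, vecMul_smul, smul_eq_zero_iff_right (sgn_ne_zero _)] at h1
  convert h1
  exact (List.ofFn_get l).symm

theorem sum_blocked_mulVec_eq_zero (hc : c ≠ 0)
    (hN : ∀ n m, U n m = (pauliX ^ (p n + p m).val) ⊗ₖ N n m)
    (hGCF : GCF (doubledP p) (mpoScaled c U) Z) (k : ℕ) {q : ℕ} (hq : 1 ≤ q)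
    (n : Fin q → Fin d) (v : (Fin q → Fin d) → Fin b → ℂ)
    (h : ∀ w w', blocked p N k w w' *ᵥ (∑ m, blocked p N q n m *ᵥ v m) = 0) :
    ∑ m, blocked p N q n m *ᵥ v m = 0 := by
  obtain ⟨q, rfl⟩ : ∃ r, q = r + 1 := ⟨q - 1, by omega⟩
  set f : (Fin (q + 1) → Fin d) → Fin d × Fin d := fun m => (n 0, m 0)
  have hsum : ∑ m, blocked p N (q + 1) n m *ᵥ v m =
      ∑ i, doubledT N i *ᵥ (∑ m with f m = i, (sgn (blockSign p n m) •
        (List.ofFn fun j : Fin q => N (n j.succ) (m j.succ)).prod) *ᵥ v m) := by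
    rw [← Finset.sum_fiberwise (s := Finset.univ) (g := f)]
    refine Finset.sum_congr rfl fun i _ => ?_
    rw [mulVec_sum]
    refine Finset.sum_congr rfl fun m hm => ?_
    rw [← (Finset.mem_filter.1 hm).2, mulVec_mulVec, blocked, List.ofFn_succ,
      List.prod_cons, mul_smul_comm]
    rfl
  rw [hsum]
  refine sum_mulVec_eq_zero_of_word hc hN hGCF k _ fun l hl => ?_
  rw [← hsum]
  subst hl
  have h1 := h (fun j => (l.get j).1) (fun j => (l.get j).2)
  rw [blocked_eq_smul_prod, smul_mulVec, smul_eq_zero_iff_right (sgn_ne_zero _)] at h1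
  convert h1
  exact (List.ofFn_get l).symm

end

/-- The two basis vectors on which `pauliX` acts, labelled by their parity. -/
def boolParity : Bool ≃ ZMod 2 where
  toFun s := if s then 1 else 0
  invFun x := decide (x = 1)
  left_inv := by decide
  right_inv := by decide

theorem pauliX_pow_val_apply (x : ZMod 2) (s t : Bool) :
    (pauliX ^ x.val) s t = if boolParity s = boolParity t + x then 1 else 0 := by
  have h : ∀ x : ZMod 2, x = 0 ∨ x = 1 := by decide
  rcases h x with rfl | rfl
  · cases s <;> cases t <;> simp [boolParity]
  · rw [ZMod.val_one, pow_one]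
    cases s <;> cases t <;> simp [pauliX, boolParity, CharTwo.add_self_eq_zero]

/-- Relabelling of a physical index and a bond index by the total parity. -/
def parityShift {ι : Type*} (β : Type*) (p : ι → ZMod 2) : ι × Bool × β ≃ ZMod 2 × ι × β where
  toFun x := (boolParity x.2.1 + p x.1, x.1, x.2.2)
  invFun y := (y.2.1, boolParity.symm (y.1 + p y.2.1), y.2.2)
  left_inv x := by
    have : boolParity x.2.1 + p x.1 + p x.1 = boolParity x.2.1 := by
      rw [add_assoc, CharTwo.add_self_eq_zero, add_zero]
    simp only [this]
    exact Prod.ext rfl (Prod.ext (Equiv.symm_apply_apply _ _) rfl)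
  right_inv y := by
    refine Prod.ext ?_ rfl
    have h := boolParity.apply_symm_apply (y.1 + p y.2.1)
    refine (congrArg (· + p y.2.1) h).trans ?_
    simp only [add_assoc, CharTwo.add_self_eq_zero, add_zero]

theorem rightRank_pauliX_kronecker {ι β : Type*} [Fintype ι] [Fintype β] (p : ι → ZMod 2)
    (V : ι → ι → Matrix (Bool × β) (Bool × β) ℂ) (B : ι → ι → Matrix β β ℂ)
    (h : ∀ n m, V n m = (pauliX ^ (p n + p m).val) ⊗ₖ B n m) :
    rightRank p V = 2 * rightRank p B := by
  have h1 : (Matrix.of fun (r c : ι × Bool × β) => sgn (p r.1 * p c.1) * V r.1 c.1 c.2 r.2) =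
      ((1 : Matrix (ZMod 2) (ZMod 2) ℂ) ⊗ₖ Matrix.of fun (r c : ι × β) =>
        sgn (p r.1 * p c.1) * B r.1 c.1 c.2 r.2).submatrix (parityShift β p) (parityShift β p) := by
    ext ⟨n, s, b⟩ ⟨m, t, a⟩
    simp only [of_apply, h, kroneckerMap_apply, submatrix_apply, parityShift, Equiv.coe_fn_mk,
      one_apply, pauliX_pow_val_apply]
    have : boolParity t = boolParity s + (p n + p m) ↔
        boolParity s + p n = boolParity t + p m := by
      rw [← add_assoc, ← CharTwo.sub_eq_add _ (p m), eq_sub_iff_add_eq, eq_comm]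
    simp only [this]
    split_ifs <;> ring
  rw [rightRank, h1, rank_submatrix, rank_kronecker, rank_one, ZMod.card, rightRank]

theorem leftRank_pauliX_kronecker {ι β : Type*} [Fintype ι] [Fintype β] (p : ι → ZMod 2)
    (V : ι → ι → Matrix (Bool × β) (Bool × β) ℂ) (B : ι → ι → Matrix β β ℂ)
    (h : ∀ n m, V n m = (pauliX ^ (p n + p m).val) ⊗ₖ B n m) :
    leftRank V = 2 * leftRank B := by
  have h1 : (Matrix.of fun (r c : ι × Bool × β) => V r.1 c.1 r.2 c.2) =
      ((1 : Matrix (ZMod 2) (ZMod 2) ℂ) ⊗ₖ Matrix.of fun (r c : ι × β) =>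
        B r.1 c.1 r.2 c.2).submatrix (parityShift β p) (parityShift β p) := by
    ext ⟨n, s, b⟩ ⟨m, t, a⟩
    simp only [of_apply, h, kroneckerMap_apply, submatrix_apply, parityShift, Equiv.coe_fn_mk,
      one_apply, pauliX_pow_val_apply]
    have : boolParity s = boolParity t + (p n + p m) ↔
        boolParity s + p n = boolParity t + p m := by
      rw [add_comm (p n), ← add_assoc, ← CharTwo.sub_eq_add _ (p n), eq_sub_iff_add_eq]
    simp only [this]
  rw [leftRank, h1, rank_submatrix, rank_kronecker, rank_one, ZMod.card, leftRank]

section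

variable {d b : ℕ} {p : Fin d → ZMod 2}
  {U : Fin d → Fin d → Matrix (Bool × Fin b) (Bool × Fin b) ℂ}
  {N : Fin d → Fin d → Matrix (Fin b) (Fin b) ℂ}

theorem rrBlocked_eq (hN : ∀ n m, U n m = (pauliX ^ (p n + p m).val) ⊗ₖ N n m) (q : ℕ) :
    rrBlocked p U q = 2 * rightRank (totalParity p q) (blocked p N q) :=
  rightRank_pauliX_kronecker _ _ _ fun n m => blocked_kronecker hN n m

theorem llBlocked_eq (hN : ∀ n m, U n m = (pauliX ^ (p n + p m).val) ⊗ₖ N n m) (q : ℕ) :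
    llBlocked p U q = 2 * leftRank (blocked p N q) :=
  leftRank_pauliX_kronecker _ _ _ fun n m => blocked_kronecker hN n m

end

theorem sum_dbl_mul_eq_rightGram {ι β : Type*} [Fintype ι] [Fintype β] (p : ι → ZMod 2)
    (B : ι → ι → Matrix β β ℂ) (ρ : β → β → ℂ) (m m' : ι) (s : ZMod 2) (α α' : β) :
    ∑ a, ∑ a', dbl p B m m' (s, α, α') (0, a, a') * ρ a a' =
      if s = p m + p m' then
        sgn (s * p m) * rightGram p B ρ (m, α) (m', α') else 0 := by
  have hs : (0 = s + p m + p m') ↔ s = p m + p m' := by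
    rw [add_assoc, eq_comm, CharTwo.add_eq_zero]
  simp only [dbl, rightGram, of_apply, hs]
  split_ifs with h
  · simp only [Finset.sum_mul, Finset.mul_sum, ← h]
    have := sum_sum_comm (ι := ι) (κ := Unit) (β := β) (γ := β) fun a a' n _ =>
      sgn (s * (p n + p m)) * (starRingEnd ℂ (B n m α a) * B n m' α' a') * ρ a a'
    simp only [Finset.univ_unique, Finset.sum_singleton] at this
    rw [this]
    refine Finset.sum_congr rfl fun n _ => Finset.sum_congr rfl fun a _ =>
      Finset.sum_congr rfl fun a' _ => ?_
    rw [mul_add, sgn_add, mul_comm (p n)]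
    ring
  · simp

theorem sum_mul_dbl_eq_leftGram {ι β : Type*} [Fintype ι] [Fintype β] (p : ι → ZMod 2)
    (B : ι → ι → Matrix β β ℂ) (ρ : β → β → ℂ) (m m' : ι) (s : ZMod 2) (γ γ' : β) :
    ∑ a, ∑ a', ρ a a' * dbl p B m m' (0, a, a') (s, γ, γ') =
      if s = p m + p m' then leftGram B ρ (m, γ) (m', γ') else 0 := by
  simp only [dbl, leftGram, of_apply, zero_add, zero_mul, sgn_zero, one_mul]
  split_ifs with h
  · simp only [Finset.mul_sum]
    have := sum_sum_comm (ι := ι) (κ := Unit) (β := β) (γ := β) fun a a' n _ =>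
      ρ a a' * (starRingEnd ℂ (B n m a γ) * B n m' a' γ')
    simp only [Finset.univ_unique, Finset.sum_singleton] at this
    rw [this]
    exact Finset.sum_congr rfl fun n _ => Finset.sum_congr rfl fun a _ =>
      Finset.sum_congr rfl fun a' _ => by ring
  · simp

theorem two_mul_rank_gram_le {ι κ β : Type*} [Fintype ι] [Fintype κ] [Fintype β]
    (p : ι → ZMod 2) (p' : κ → ZMod 2) (B : ι → ι → Matrix β β ℂ) (B' : κ → κ → Matrix β β ℂ)
    (ρ τ : β → β → ℂ) (c : ℂ) (hc : c ≠ 0)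
    (h : ∀ m₁ m₁' m₂ m₂' r t, (dbl p B m₁ m₁' * dbl p' B' m₂ m₂') r t =
      c * (∑ a, ∑ a', dbl p B m₁ m₁' r (0, a, a') * ρ a a') *
        (∑ a, ∑ a', τ a a' * dbl p' B' m₂ m₂' (0, a, a') t)) :
    2 * ((rightGram p B ρ).rank * (leftGram B' τ).rank) ≤ Fintype.card ι * Fintype.card κ := by
  have key : ∀ (s : ZMod 2) (m m' : ι × κ) (α α' γ γ' : β),
      ∑ n, sgn (s * (pairParity p p' n + pairParity p p' m)) *
        (starRingEnd ℂ (compMPO p p' B B' n m α γ) * compMPO p p' B B' n m' α' γ') =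
      if s = p m.1 + p m'.1 then
        sgn ((p' m.2 + p' m'.2) * p m'.1 + s * p m.1) * c *
          (rightGram p B ρ (m.1, α) (m'.1, α') * leftGram B' τ (m.2, γ) (m'.2, γ')) else 0 := by
    intro s m m' α α' γ γ'
    have h1 := congrFun (congrFun (dbl_mul p p' B B' m.1 m'.1 m.2 m'.2) (s, α, α'))
      (s + pairParity p p' m + pairParity p p' m', γ, γ')
    rw [h, sum_dbl_mul_eq_rightGram, sum_mul_dbl_eq_leftGram, Matrix.smul_apply, smul_eq_mul, dbl,
      of_apply, if_pos rfl] at h1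
    have h2 := congrArg (sgn ((p' m.2 + p' m'.2) * p m'.1) * ·) h1
    simp only [← mul_assoc, sgn_mul_self, one_mul] at h2
    simp only [← mul_assoc]
    rw [← h2]
    split_ifs with h3 h4 h4
    · rw [sgn_add]; ring
    · refine absurd ?_ h4
      simp only [h3, pairParity]
      linear_combination (p m.1 + p m'.1) * (CharTwo.two_eq_zero : (2 : ZMod 2) = 0)
    · simp
    · simp
  set Y : Matrix (ι × κ) (ZMod 2 × (ι × β) × (κ × β)) ℂ := Matrix.of fun n x =>
    if pairParity p p' n = x.1 then
      compMPO p p' B B' n (x.2.1.1, x.2.2.1) x.2.1.2 x.2.2.2 else 0 with hY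
  set u : ZMod 2 × (ι × β) × (κ × β) → ℂ := fun x =>
    sgn (p x.2.1.1 * x.1 + p x.2.1.1 * p' x.2.2.1) with hu
  have hrank : (Yᴴ * Y).rank =
      ((1 : Matrix (ZMod 2) (ZMod 2) ℂ) ⊗ₖ (rightGram p B ρ ⊗ₖ leftGram B' τ)).rank := by
    refine rank_sign _ _ (fun x => 2⁻¹ * c * u x) u
      (fun x => mul_ne_zero (mul_ne_zero (by norm_num) hc) (sgn_ne_zero _))
      (fun x => sgn_ne_zero _) ?_
    rintro ⟨t, ⟨m₁, α⟩, m₂, γ⟩ ⟨t', ⟨m₁', α'⟩, m₂', γ'⟩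
    simp only [mul_apply, conjTranspose_apply, hY, of_apply, kroneckerMap_apply, one_apply, hu]
    by_cases ht : t = t'
    · subst ht
      have hdelta : ∀ n, (if pairParity p p' n = t then (1 : ℂ) else 0) =
          2⁻¹ * ∑ s, sgn (s * (t + pairParity p p' (m₁, m₂))) *
            sgn (s * (pairParity p p' n + pairParity p p' (m₁, m₂))) := fun n => by
        simp only [← sgn_add, ← mul_add]
        have : t + pairParity p p' (m₁, m₂) +
            (pairParity p p' n + pairParity p p' (m₁, m₂)) = pairParity p p' n + t := by
          linear_combination pairParity p p' (m₁, m₂) * (CharTwo.two_eq_zero : (2 : ZMod 2) = 0)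
        rw [this, sum_sgn_mul]
        simp only [CharTwo.add_eq_zero]
        split_ifs <;> simp
      have hterm : ∀ n, star (if pairParity p p' n = t then
            compMPO p p' B B' n (m₁, m₂) α γ else 0) *
          (if pairParity p p' n = t then compMPO p p' B B' n (m₁', m₂') α' γ' else 0) =
          ∑ s, 2⁻¹ * sgn (s * (t + pairParity p p' (m₁, m₂))) *
            (sgn (s * (pairParity p p' n + pairParity p p' (m₁, m₂))) *
            (starRingEnd ℂ (compMPO p p' B B' n (m₁, m₂) α γ) *
              compMPO p p' B B' n (m₁', m₂') α' γ')) := fun n => by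
        have h1 := congrArg (· * (starRingEnd ℂ (compMPO p p' B B' n (m₁, m₂) α γ) *
              compMPO p p' B B' n (m₁', m₂') α' γ')) (hdelta n)
        simp only [Finset.mul_sum, Finset.sum_mul] at h1
        simp only [← mul_assoc] at h1 ⊢
        rw [← h1]
        split_ifs <;> simp
      rw [Finset.sum_congr rfl fun n _ => hterm n, Finset.sum_comm]
      simp only [← Finset.mul_sum, key]
      rw [Finset.sum_eq_single (p m₁ + p m₁') (fun s _ hs => by rw [if_neg hs, mul_zero]) (by simp),
        if_pos rfl, if_true, one_mul]
      have hsign : sgn ((p m₁ + p m₁') * (t + pairParity p p' (m₁, m₂))) *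
          sgn ((p' m₂ + p' m₂') * p m₁' + (p m₁ + p m₁') * p m₁) =
          sgn (p m₁ * t + p m₁ * p' m₂) * sgn (p m₁' * t + p m₁' * p' m₂') := by
        simp only [← sgn_add, pairParity]
        congr 1
        linear_combination (p m₁ * (p m₁ + p m₁') + p m₁' * p' m₂) *
          (CharTwo.two_eq_zero : (2 : ZMod 2) = 0)
      linear_combination 2⁻¹ * c *
        (rightGram p B ρ (m₁, α) (m₁', α') * leftGram B' τ (m₂, γ) (m₂', γ')) * hsign
    · rw [if_neg ht, zero_mul, mul_zero, zero_mul]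
      refine Finset.sum_eq_zero fun n _ => ?_
      by_cases hn : pairParity p p' n = t
      · rw [if_neg (fun h => ht (hn.symm.trans h)), mul_zero]
      · rw [if_neg hn, star_zero, zero_mul]
  rw [rank_kronecker, rank_kronecker, rank_one, ZMod.card, rank_conjTranspose_mul_self] at hrank
  rw [← hrank, ← Fintype.card_prod]
  exact rank_le_card_height _

theorem rank_sum_sum_le {μ ν σ τ β γ : Type*} [Fintype μ] [Fintype ν] [Fintype σ] [Fintype τ]
    [Fintype β] [Fintype γ] (T : Matrix σ τ ℂ) (u : μ → β → σ) (v : ν → γ → τ) (g : ν → ℂ) :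
    (Matrix.of fun n m => (∑ b, ∑ a, T (u n b) (v m a)) * g m).rank ≤ T.rank := by
  classical
  set X : Matrix μ σ ℂ := Matrix.of fun n i => ∑ b, if u n b = i then 1 else 0 with hX
  set Y : Matrix τ ν ℂ := Matrix.of fun j m => ∑ a, if v m a = j then g m else 0 with hY
  have h1 : ∀ (M : Matrix σ ν ℂ) n m, (X * M) n m = ∑ b, M (u n b) m := fun M n m => by
    simp only [hX, mul_apply, of_apply, Finset.sum_mul]
    rw [Finset.sum_comm]
    simp
  have h2 : ∀ i m, (T * Y) i m = ∑ a, T i (v m a) * g m := fun i m => by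
    simp only [hY, mul_apply, of_apply, Finset.mul_sum]
    rw [Finset.sum_comm]
    simp
  have h : (Matrix.of fun n m => (∑ b, ∑ a, T (u n b) (v m a)) * g m) = X * (T * Y) := by
    ext n m
    simp only [h1, h2, of_apply, Finset.sum_mul]
  rw [h]
  exact (rank_mul_le_right _ _).trans (rank_mul_le_left _ _)

theorem card_le_two_mul_rank {ι κ β : Type*} [Fintype ι] [Fintype κ] [Fintype β]
    (p : ι → ZMod 2) (p' : κ → ZMod 2) (B : ι → ι → Matrix β β ℂ) (B' : κ → κ → Matrix β β ℂ)
    (z : ℂ) [DecidableEq ι] [DecidableEq κ]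
    (h : IsUnit (Matrix.of fun n m : ι × κ => z *
      ((if pairParity p p' n = pairParity p p' m then 2 else 0) *
        (compMPO p p' B B' n m).trace))) :
    Fintype.card ι * Fintype.card κ ≤ 2 * (rightRank p B * leftRank B') := by
  rw [← Fintype.card_prod, ← rank_of_isUnit _ h]
  set T : Matrix (ZMod 2 × (ι × β) × (κ × β)) (ZMod 2 × (ι × β) × (κ × β)) ℂ :=
    1 ⊗ₖ ((Matrix.of fun (r c : ι × β) => sgn (p r.1 * p c.1) * B r.1 c.1 c.2 r.2) ⊗ₖ
      Matrix.of fun (r c : κ × β) => B' r.1 c.1 r.2 c.2) with hT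
  have hr : T.rank = 2 * (rightRank p B * leftRank B') := by
    rw [hT, rank_kronecker, rank_kronecker, rank_one, ZMod.card]
    rfl
  rw [← hr]
  refine le_of_eq_of_le (congrArg Matrix.rank ?_) (rank_sum_sum_le T
    (fun (n : ι × κ) (b : β) => (pairParity p p' n, (n.1, b), (n.2, b)))
    (fun (m : ι × κ) (a : β) => (pairParity p p' m, (m.1, a), (m.2, a)))
    (fun m => z * (2 * sgn (p m.1))))
  ext n m
  simp only [of_apply, hT, kroneckerMap_apply, one_apply]
  split_ifs with hp
  · have hs : sgn (p m.1 * (p' n.2 + p' m.2)) = sgn (p n.1 * p m.1) * sgn (p m.1) := by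
      have h2 : p' n.2 + p' m.2 = p n.1 + p m.1 := by
        simp only [pairParity] at hp
        linear_combination hp + (p' m.2 - p n.1) * (CharTwo.two_eq_zero : (2 : ZMod 2) = 0)
      have h3 : ∀ x : ZMod 2, x * x = x := by decide
      rw [h2, mul_add, h3, ← sgn_add, mul_comm (p n.1)]
    rw [compMPO, hs, trace_smul, trace, smul_eq_mul]
    simp only [diag_apply, mul_apply, one_mul, mul_assoc, ← Finset.mul_sum]
    rw [Finset.sum_comm]
    ring
  · simp

section

variable {d b : ℕ} {p : Fin d → ZMod 2} {Z : Matrix (Bool × Fin b) (Bool × Fin b) ℂ} {c : ℂ}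
  {U : Fin d → Fin d → Matrix (Bool × Fin b) (Bool × Fin b) ℂ}
  {N : Fin d → Fin d → Matrix (Fin b) (Fin b) ℂ}

theorem pow_add_le_two_mul_rank (hN : ∀ n m, U n m = (pauliX ^ (p n + p m).val) ⊗ₖ N n m)
    {q r : ℕ} (hU : ((Real.sqrt 2 : ℂ))⁻¹ • fMPO p U (q + r) ∈
      Matrix.unitaryGroup (Fin (q + r) → Fin d) ℂ) :
    d ^ (q + r) ≤ 2 * (rightRank (totalParity p q) (blocked p N q) *
      leftRank (blocked p N r)) := by
  have h := card_le_two_mul_rank (totalParity p q) (totalParity p r) (blocked p N q)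
    (blocked p N r) ((Real.sqrt 2 : ℂ))⁻¹ ?_
  · simpa [pow_add] using h
  · have h1 : IsUnit (((Real.sqrt 2 : ℂ))⁻¹ • fMPO p U (q + r)) :=
      IsUnit.of_mul_eq_one _ (mem_unitaryGroup_iff.1 hU)
    have h2 := h1.map (reindexAlgEquiv ℂ ℂ (Fin.appendEquiv q r).symm)
    convert h2 using 1
    ext n m
    simp only [of_apply, coe_reindexAlgEquiv, reindex_apply, submatrix_apply, Matrix.smul_apply,
      smul_eq_mul, fMPO_apply_eq hN, Equiv.symm_symm]
    simp only [Fin.appendEquiv, Equiv.coe_fn_mk, blocked_append, totalParity_append, pairParity]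
    rfl

theorem exists_two_mul_rank_eq (hd : 1 ≤ d) (hc : c ≠ 0)
    (hN : ∀ n m, U n m = (pauliX ^ (p n + p m).val) ⊗ₖ N n m)
    (hGCF : GCF (doubledP p) (mpoScaled c U) Z)
    (hU : ∀ q : ℕ, 1 ≤ q →
      ((Real.sqrt 2 : ℂ))⁻¹ • fMPO p U q ∈ Matrix.unitaryGroup (Fin q → Fin d) ℂ) :
    ∃ k : ℕ, 1 ≤ k ∧ ∀ q r : ℕ, k ≤ q → k ≤ r →
      2 * (rightRank (totalParity p q) (blocked p N q) * leftRank (blocked p N r)) =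
        d ^ (q + r) := by
  obtain ⟨k, hk, z, hz, h⟩ := exists_dbl_mul_dbl_eq hd hN hU
  refine ⟨k, hk, fun q r hq hr => le_antisymm ?_ (pow_add_le_two_mul_rank hN (hU _ (by omega)))⟩
  have h1 := two_mul_rank_gram_le (totalParity p q) (totalParity p r) (blocked p N q)
    (blocked p N r) (leftDens (blocked p N k)) (rightDens (blocked p N k)) z hz (h q r hq hr)
  rw [rank_rightGram _ _ _ (sum_vecMul_blocked_eq_zero hc hN hGCF k (by omega)),
    rank_leftGram _ _ (sum_blocked_mulVec_eq_zero hc hN hGCF k (by omega))] at h1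
  simpa [pow_add] using h1

end

/-- Index theory for type II fMPUs with antiperiodic boundary
conditions: after blocking sufficiently many times one has `r·ℓ = 2·d^{2q}` and the
exponentiated index `√(r/ℓ)` is independent of `q` and equals `√2` times a positive
rational number. -/
theorem typeII_index {d b : ℕ} (hd : 1 ≤ d) (p : Fin d → ZMod 2)
    (U : Fin d → Fin d → Matrix (Bool × Fin b) (Bool × Fin b) ℂ)
    (hE : EvenTensor (doubledP p) (doubledT U) (ZBP b))
    (hstruct : TypeIIStruct p U)
    (hGCF : GCF (doubledP p) (mpoScaled ((Real.sqrt d : ℂ))⁻¹ U) (ZBP b))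
    (hunit : ∀ N : ℕ, 1 ≤ N →
      ((Real.sqrt 2 : ℂ))⁻¹ • fMPO p U N ∈ Matrix.unitaryGroup (Fin N → Fin d) ℂ) :
    ∃ k : ℕ, 1 ≤ k ∧
      (∀ q : ℕ, k ≤ q →
        rrBlocked p U q * llBlocked p U q = 2 * d ^ (2 * q)) ∧
      ∃ c : ℚ, 0 < c ∧ ∀ q : ℕ, k ≤ q →
        Real.sqrt ((rrBlocked p U q : ℝ) / (llBlocked p U q : ℝ)) =
          Real.sqrt 2 * (c : ℝ) := by
  obtain ⟨N, hN⟩ := hstruct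
  have hd0 : (0 : ℝ) < d := Nat.cast_pos.2 (by omega)
  have hc : ((Real.sqrt d : ℂ))⁻¹ ≠ 0 :=
    inv_ne_zero (Complex.ofReal_ne_zero.2 (Real.sqrt_pos.2 hd0).ne')
  obtain ⟨k, hk, h⟩ := exists_two_mul_rank_eq hd hc hN hGCF hunit
  refine ⟨k, hk, fun q hq => ?_, rightRank (totalParity p k) (blocked p N k) / d ^ k, ?_,
    fun q hq => ?_⟩
  · rw [rrBlocked_eq hN, llBlocked_eq hN, two_mul q, ← h q q hq hq]
    ring
  · have h1 := h k k le_rfl le_rfl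
    have h2 : 0 < d ^ (k + k) := pow_pos (by omega) _
    have h3 : rightRank (totalParity p k) (blocked p N k) ≠ 0 := by
      intro h0
      rw [h0] at h1
      omega
    have h4 : (0 : ℚ) < d := Nat.cast_pos.2 (by omega)
    have h5 : (0 : ℚ) < rightRank (totalParity p k) (blocked p N k) :=
      Nat.cast_pos.2 (Nat.pos_of_ne_zero h3)
    positivity
  · have h1 : (2 * (rightRank (totalParity p q) (blocked p N q) * leftRank (blocked p N q)) : ℝ) =
        d ^ q * d ^ q := by
      rw [← pow_add]; exact_mod_cast h q q hq hq
    have h2 : (2 * (rightRank (totalParity p k) (blocked p N k) * leftRank (blocked p N q)) : ℝ) =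
        d ^ k * d ^ q := by
      rw [← pow_add]; exact_mod_cast h k q le_rfl hq
    have hk0 : (0 : ℝ) < (d : ℝ) ^ k := pow_pos hd0 _
    have hq0 : (0 : ℝ) < (d : ℝ) ^ q := pow_pos hd0 _
    rw [rrBlocked_eq hN, llBlocked_eq hN]
    push_cast
    set x := (Nat.cast (rightRank (totalParity p q) (blocked p N q)) : ℝ)
    set y := (Nat.cast (leftRank (blocked p N q)) : ℝ)
    set w := (Nat.cast (rightRank (totalParity p k) (blocked p N k)) : ℝ)
    have hy : y ≠ 0 := by
      intro h0
      rw [h0, mul_zero, mul_zero] at h1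
      exact (mul_pos hq0 hq0).ne h1
    have hw : w / (d : ℝ) ^ k = d ^ q / (2 * y) := by
      field_simp
      linarith
    have hx : 2 * x / (2 * y) = 2 * (w / (d : ℝ) ^ k) ^ 2 := by
      rw [hw]
      field_simp
      linarith
    rw [hx, Real.sqrt_mul (by norm_num), Real.sqrt_sq (div_nonneg (Nat.cast_nonneg _) hk0.le)]
end

end FQCA
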